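/- arXiv:1304.3754 — 3 statements merged into one kernel-verified Lean document; each statement's English description precedes it below -/
import Mathlib

section
/- There exists a constant C > 0 such that for every k ≤ d there is a d-variate multilinear polynomial p satisfying: (i) |p(x) − OR_d(x)| ≤ 1/400 for every x ∈ {-1,1}^d with at most k coordinates equal to −1, (ii) the L₁-norm of the coefficient vector of p is at most d^{0.01}, and (iii) deg(p) ≤ min{d^{1−1/(C√k)}, d/log^{0.995} d}. -/
open Classical in
/-- Degree of a multilinear polynomial given by its coefficient vector. -/
noncomputable def polyDegree {ι : Type*} [Fintype ι] (c : Finset ι → ℝ) : ℕ :=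
  Finset.sup (Finset.univ.filter fun S => c S ≠ 0) Finset.card

/-- Evaluation of a multilinear polynomial given by its coefficient vector. -/
noncomputable def evalPoly {ι : Type*} [Fintype ι] (c : Finset ι → ℝ) (x : ι → ℝ) : ℝ :=
  ∑ S : Finset ι, c S * ∏ i ∈ S, x i

/-- Weight (L1-norm of the coefficient vector) of a multilinear polynomial. -/
noncomputable def weight {ι : Type*} [Fintype ι] (c : Finset ι → ℝ) : ℝ :=
  ∑ S : Finset ι, |c S|

open Classical in
/-- The OR function on `{-1,1}^d`, with `-1` = TRUE. -/
noncomputable def ORd {d : ℕ} (x : Fin d → ℝ) : ℝ :=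
  if ∃ i, x i = -1 then -1 else 1

/-- The Boolean cube `{-1,1}^d` inside `ℝ^d`. -/
def cube (d : ℕ) : Set (Fin d → ℝ) := {x | ∀ i, x i = 1 ∨ x i = -1}

open Classical in
/-- Hamming weight: number of coordinates equal to `-1`. -/
noncomputable def hamming {d : ℕ} (x : Fin d → ℝ) : ℕ :=
  (Finset.univ.filter fun i => x i = -1).card

open Classical in
/-- `f` agrees on the cube with a multilinear polynomial of weight at most `w`, degree at most `D`. -/
def PRep {d : ℕ} (f : (Fin d → ℝ) → ℝ) (w : ℝ) (D : ℕ) : Prop :=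
  ∃ c : Finset (Fin d) → ℝ, (∀ x ∈ cube d, evalPoly c x = f x) ∧ weight c ≤ w ∧
    ∀ S, c S ≠ 0 → S.card ≤ D

lemma PRep.mono {d : ℕ} {f : (Fin d → ℝ) → ℝ} {w w' : ℝ} {D D' : ℕ} (h : PRep f w D)
    (hw : w ≤ w') (hD : D ≤ D') : PRep f w' D' := by
  obtain ⟨c, h1, h2, h3⟩ := h
  exact ⟨c, h1, h2.trans hw, fun S hS => (h3 S hS).trans hD⟩

lemma PRep.congr {d : ℕ} {f g : (Fin d → ℝ) → ℝ} {w : ℝ} {D : ℕ} (h : PRep f w D)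
    (hfg : ∀ x ∈ cube d, f x = g x) : PRep g w D := by
  obtain ⟨c, h1, h2, h3⟩ := h
  exact ⟨c, fun x hx => (h1 x hx).trans (hfg x hx), h2, h3⟩

lemma PRep.nonneg {d : ℕ} {f : (Fin d → ℝ) → ℝ} {w : ℝ} {D : ℕ} (h : PRep f w D) : 0 ≤ w := by
  obtain ⟨c, h1, h2, h3⟩ := h
  exact le_trans (Finset.sum_nonneg fun _ _ => abs_nonneg _) h2

lemma rep_monomial {d : ℕ} (A : Finset (Fin d)) (a : ℝ) :
    PRep (fun x => a * ∏ i ∈ A, x i) |a| A.card := by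
  classical
  refine ⟨fun S => if S = A then a else 0, ?_, ?_, ?_⟩
  · intro x _
    simp [evalPoly]
  · simp [weight, apply_ite abs]
  · intro S hS
    have : S = A := by
      by_contra h
      simp [h] at hS
    rw [this]

lemma rep_const {d : ℕ} (a : ℝ) : PRep (fun _ : Fin d → ℝ => a) |a| 0 := by
  simpa using rep_monomial (d := d) ∅ a

lemma rep_var {d : ℕ} (i : Fin d) : PRep (fun x : Fin d → ℝ => x i) 1 1 := by
  simpa using rep_monomial (d := d) {i} 1

lemma PRep.add {d : ℕ} {f g : (Fin d → ℝ) → ℝ} {w v : ℝ} {D E : ℕ} (hf : PRep f w D)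
    (hg : PRep g v E) : PRep (fun x => f x + g x) (w + v) (max D E) := by
  obtain ⟨a, h1, h2, h3⟩ := hf
  obtain ⟨b, k1, k2, k3⟩ := hg
  refine ⟨fun S => a S + b S, ?_, ?_, ?_⟩
  · intro x hx
    beta_reduce
    rw [← h1 x hx, ← k1 x hx]
    simp only [evalPoly, add_mul, Finset.sum_add_distrib]
  · refine le_trans ?_ (add_le_add h2 k2)
    simp only [weight, ← Finset.sum_add_distrib]
    exact Finset.sum_le_sum fun S _ => abs_add_le _ _
  · intro S hS
    by_cases ha : a S = 0
    · have hb : b S ≠ 0 := by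
        intro hb
        simp [ha, hb] at hS
      exact (k3 S hb).trans (le_max_right _ _)
    · exact (h3 S ha).trans (le_max_left _ _)

lemma PRep.smul {d : ℕ} {f : (Fin d → ℝ) → ℝ} {w : ℝ} {D : ℕ} (hf : PRep f w D) (r : ℝ) :
    PRep (fun x => r * f x) (|r| * w) D := by
  obtain ⟨a, h1, h2, h3⟩ := hf
  refine ⟨fun S => r * a S, ?_, ?_, ?_⟩
  · intro x hx
    beta_reduce
    rw [← h1 x hx]
    simp only [evalPoly, Finset.mul_sum, mul_assoc]
  · refine le_trans (le_of_eq ?_) (mul_le_mul_of_nonneg_left h2 (abs_nonneg r))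
    simp only [weight, Finset.mul_sum, abs_mul]
  · intro S hS
    exact h3 S (right_ne_zero_of_mul hS)

lemma chi_mul {d : ℕ} (A B : Finset (Fin d)) (x : Fin d → ℝ) (hx : x ∈ cube d) :
    ∏ i ∈ symmDiff A B, x i = (∏ i ∈ A, x i) * ∏ i ∈ B, x i := by
  have key : ∀ S : Finset (Fin d), ∏ i ∈ S, x i = ∏ i, if i ∈ S then x i else 1 := by
    intro S
    simp [Finset.prod_ite_mem]
  rw [key, key A, key B, ← Finset.prod_mul_distrib]
  refine Finset.prod_congr rfl fun i _ => ?_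
  have hi : x i * x i = 1 := by
    rcases hx i with h | h <;> simp [h]
  by_cases hA : i ∈ A <;> by_cases hB : i ∈ B <;> simp [Finset.mem_symmDiff, hA, hB, hi]

lemma PRep.mul {d : ℕ} {f g : (Fin d → ℝ) → ℝ} {w v : ℝ} {D E : ℕ} (hf : PRep f w D)
    (hg : PRep g v E) : PRep (fun x => f x * g x) (w * v) (D + E) := by
  classical
  have hw := hf.nonneg
  obtain ⟨a, h1, h2, h3⟩ := hf
  obtain ⟨b, k1, k2, k3⟩ := hg
  refine ⟨fun S => ∑ A, ∑ B, if symmDiff A B = S then a A * b B else 0, ?_, ?_, ?_⟩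
  · intro x hx
    beta_reduce
    rw [← h1 x hx, ← k1 x hx]
    simp only [evalPoly, Finset.sum_mul]
    rw [Finset.sum_comm]
    refine Finset.sum_congr rfl fun A _ => ?_
    rw [Finset.sum_comm, Finset.mul_sum]
    refine Finset.sum_congr rfl fun B _ => ?_
    simp only [ite_mul, zero_mul, Finset.sum_ite_eq, Finset.mem_univ, if_true]
    rw [chi_mul A B x hx]
    ring
  · have hb0 : 0 ≤ weight b := Finset.sum_nonneg fun _ _ => abs_nonneg _
    refine le_trans ?_ (mul_le_mul h2 k2 hb0 hw)
    calc weight (fun S => ∑ A, ∑ B, if symmDiff A B = S then a A * b B else 0)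
        ≤ ∑ S : Finset (Fin d), ∑ A : Finset (Fin d), ∑ B : Finset (Fin d),
            (if symmDiff A B = S then |a A| * |b B| else 0) := by
          refine Finset.sum_le_sum fun S _ => ?_
          refine (Finset.abs_sum_le_sum_abs _ _).trans (Finset.sum_le_sum fun A _ => ?_)
          refine (Finset.abs_sum_le_sum_abs _ _).trans (Finset.sum_le_sum fun B _ => ?_)
          split_ifs <;> simp [abs_mul]
      _ = weight a * weight b := by
          simp only [weight, Finset.sum_mul]
          rw [Finset.sum_comm]
          refine Finset.sum_congr rfl fun A _ => ?_
          rw [Finset.sum_comm, Finset.mul_sum]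
          refine Finset.sum_congr rfl fun B _ => ?_
          simp
  · intro S hS
    obtain ⟨A, _, hA⟩ := Finset.exists_ne_zero_of_sum_ne_zero hS
    obtain ⟨B, _, hB⟩ := Finset.exists_ne_zero_of_sum_ne_zero hA
    split_ifs at hB with hAB
    · have e1 := h3 A (left_ne_zero_of_mul hB)
      have e2 := k3 B (right_ne_zero_of_mul hB)
      rw [← hAB]
      have : (symmDiff A B).card ≤ (A ∪ B).card := by
        refine Finset.card_le_card fun i hi => ?_
        rw [Finset.mem_symmDiff] at hi
        rw [Finset.mem_union]
        tauto
      have := Finset.card_union_le A B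
      omega
    · exact absurd rfl hB

lemma rep_block {d : ℕ} (B : Finset (Fin d)) :
    PRep (fun x : Fin d → ℝ => ∏ i ∈ B, ((1 + x i) / 2)) 1 B.card := by
  classical
  induction B using Finset.induction_on with
  | empty => simpa using rep_const (d := d) 1
  | insert i B hi ih =>
    have h1 : PRep (fun x : Fin d → ℝ => (1 + x i) / 2) 1 1 := by
      have := ((rep_const (d := d) 1).add (rep_var i)).smul (1 / 2)
      refine (this.mono ?_ ?_).congr ?_
      · norm_num [abs_of_pos]
      · simp
      · intro x _
        ring
    have := h1.mul ih
    simp only [Finset.prod_insert hi, Finset.card_insert_of_notMem hi]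
    exact this.mono (by norm_num) (by omega)

lemma rep_sum {d : ℕ} {α : Type*} (s : Finset α) (f : α → (Fin d → ℝ) → ℝ) (w : ℝ) (D : ℕ)
    (h : ∀ a ∈ s, PRep (f a) w D) : PRep (fun x => ∑ a ∈ s, f a x) (s.card * w) D := by
  classical
  induction s using Finset.induction_on with
  | empty => simpa using (rep_const (d := d) 0).mono (by simp : |(0:ℝ)| ≤ 0) (Nat.zero_le D)
  | insert a s ha ih =>
    have h1 := (h a (by simp)).add (ih fun b hb => h b (by simp [hb]))
    simp only [Finset.sum_insert ha, Finset.card_insert_of_notMem ha]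
    refine h1.mono (le_of_eq ?_) (by simp)
    push_cast
    ring

/-- Chebyshev polynomials through the recurrence. -/
noncomputable def cheb (z : ℝ) (n : ℕ) : ℝ := (Polynomial.Chebyshev.T ℝ n).eval z

lemma cheb_zero (z : ℝ) : cheb z 0 = 1 := by simp [cheb]
lemma cheb_one (z : ℝ) : cheb z 1 = z := by simp [cheb]
lemma cheb_rec (z : ℝ) (n : ℕ) : cheb z (n + 2) = 2 * z * cheb z (n + 1) - cheb z n := by
  simp [cheb, Polynomial.Chebyshev.T_add_two]

lemma cheb_abs (z : ℝ) (h : |z| ≤ 1) (n : ℕ) : |cheb z n| ≤ 1 := by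
  obtain ⟨h1, h2⟩ := abs_le.mp h
  rw [cheb, ← Real.cos_arccos h1 h2, Polynomial.Chebyshev.T_real_cos]
  exact Real.abs_cos_le_one _

lemma cheb_large (z : ℝ) (h : 1 ≤ z) (n : ℕ) :
    1 + (n : ℝ) ^ 2 * (z - 1) ≤ cheb z n ∧
      (2 * n + 1 : ℝ) * (z - 1) ≤ cheb z (n + 1) - cheb z n := by
  induction n with
  | zero => simp [cheb_zero, cheb_one]
  | succ n ih =>
    obtain ⟨h1, h2⟩ := ih
    have h3 : 1 + ((n + 1 : ℕ) : ℝ) ^ 2 * (z - 1) ≤ cheb z (n + 1) := by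
      push_cast
      nlinarith
    refine ⟨h3, ?_⟩
    rw [cheb_rec]
    have h4 : 1 ≤ cheb z (n + 1) := by
      have : 0 ≤ ((n + 1 : ℕ) : ℝ) ^ 2 * (z - 1) := by
        have := sub_nonneg.mpr h
        positivity
      linarith
    push_cast
    nlinarith [mul_nonneg (sub_nonneg.mpr h) (sub_nonneg.mpr h4)]

lemma rep_cheb {d : ℕ} {f : (Fin d → ℝ) → ℝ} {w : ℝ} {D : ℕ} (hf : PRep f w D) (hw : 1 ≤ w)
    (n : ℕ) : PRep (fun x => cheb (f x) n) ((3 * w) ^ n) (n * D) ∧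
      PRep (fun x => cheb (f x) (n + 1)) ((3 * w) ^ (n + 1)) ((n + 1) * D) := by
  induction n with
  | zero =>
    constructor
    · simpa [cheb_zero] using rep_const (d := d) 1
    · simp only [zero_add, cheb_one]
      exact hf.mono (by linarith) (by omega)
  | succ n ih =>
    obtain ⟨h1, h2⟩ := ih
    refine ⟨h2, ?_⟩
    have := ((hf.mul h2).smul 2).add (h1.smul (-1))
    refine (this.mono ?_ ?_).congr ?_
    · have e : (3 * w) ^ n ≤ (3 * w) ^ n * w ^ 2 := by
        have : 1 ≤ w ^ 2 := by nlinarith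
        have h0 : 0 ≤ (3 * w) ^ n := by positivity
        nlinarith
      have h0 : 0 ≤ (3 * w) ^ n * w ^ 2 := by positivity
      norm_num
      ring_nf at e h0 ⊢
      nlinarith
    · refine max_le (le_of_eq (by ring)) (Nat.mul_le_mul_right D (by omega))
    · intro x _
      show _ = cheb (f x) (n + 2)
      rw [cheb_rec]
      ring

/-- Number of blocks containing a `-1`. -/
noncomputable def blk (d N : ℕ) (x : Fin d → ℝ) : ℝ :=
  ∑ j ∈ Finset.range N,
    (1 - ∏ i ∈ Finset.univ.filter (fun i : Fin d => i.val / (d / N + 1) = j), ((1 + x i) / 2))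

lemma blk_rep (d N : ℕ) : PRep (blk d N) (N * 2) (d / N + 1) := by
  have := rep_sum (d := d) (Finset.range N) (fun j x =>
    (1 - ∏ i ∈ Finset.univ.filter (fun i : Fin d => i.val / (d / N + 1) = j), ((1 + x i) / 2)))
    2 (d / N + 1) ?_
  · rw [Finset.card_range] at this
    exact this
  · intro j _
    have h := (rep_const (d := d) 1).add
      ((rep_block (Finset.univ.filter (fun i : Fin d => i.val / (d / N + 1) = j))).smul (-1))
    refine (h.mono (by norm_num) ?_).congr ?_
    · rw [Nat.zero_max]
      set b := d / N + 1 with hb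
      have hb0 : 0 < b := Nat.succ_pos _
      have : (Finset.univ.filter (fun i : Fin d => i.val / b = j)).card
          ≤ (Finset.Ico (j * b) (j * b + b)).card := by
        refine Finset.card_le_card_of_injOn (fun i => i.val) ?_ ?_
        · intro i hi
          simp only [Finset.coe_filter, Finset.mem_univ, true_and, Set.mem_ofPred_eq] at hi
          simp only [Finset.coe_Ico, Set.mem_Ico]
          rw [Nat.div_eq_iff hb0] at hi
          constructor
          · exact hi.1
          · omega
        · intro i _ j _ hij
          exact Fin.ext hij
      simpa using this
    · intro x _
      ring

lemma blk_val (d N : ℕ) (hN : 0 < N) (x : Fin d → ℝ) (hx : x ∈ cube d) :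
    ((∃ i, x i = -1) → 1 ≤ blk d N x) ∧ ((¬ ∃ i, x i = -1) → blk d N x = 0) ∧
      blk d N x ≤ hamming x ∧ blk d N x ≤ N := by
  classical
  set b := d / N + 1 with hb
  set T : Finset (Fin d) := Finset.univ.filter fun i => x i = -1 with hT
  set J : Finset ℕ := T.image (fun i => i.val / b) with hJ
  have hJN : J ⊆ Finset.range N := by
    intro j hj
    simp only [hJ, Finset.mem_image] at hj
    obtain ⟨i, _, rfl⟩ := hj
    rw [Finset.mem_range, Nat.div_lt_iff_lt_mul (Nat.succ_pos _)]
    have h1 := i.isLt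
    have h2 := Nat.lt_mul_div_succ d hN
    exact h1.trans h2
  have hval : blk d N x = J.card := by
    have : ∀ j ∈ Finset.range N,
        (1 - ∏ i ∈ Finset.univ.filter (fun i : Fin d => i.val / b = j), ((1 + x i) / 2))
          = if j ∈ J then (1 : ℝ) else 0 := by
      intro j _
      split_ifs with hj
      · simp only [hJ, Finset.mem_image] at hj
        obtain ⟨i, hi, hij⟩ := hj
        rw [Finset.prod_eq_zero (i := i)]
        · simp
        · simp [hij]
        · simp only [hT, Finset.mem_filter, Finset.mem_univ, true_and] at hi
          simp [hi]
      · rw [Finset.prod_eq_one]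
        · simp
        · intro i hi
          simp only [Finset.mem_filter, Finset.mem_univ, true_and] at hi
          rcases hx i with h | h
          · rw [h]; norm_num
          · exact absurd (Finset.mem_image.mpr ⟨i, by simp [hT, h], hi⟩) hj
    unfold blk
    rw [← hb, Finset.sum_congr rfl this, Finset.sum_ite_mem, Finset.inter_eq_right.mpr hJN]
    simp
  rw [hval]
  refine ⟨?_, ?_, ?_, ?_⟩
  · rintro ⟨i, hi⟩
    have : 0 < J.card := Finset.card_pos.mpr ⟨i.val / b, Finset.mem_image.mpr ⟨i, by simp [hT, hi], rfl⟩⟩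
    exact_mod_cast this
  · intro h
    have : T = ∅ := by
      rw [hT, Finset.filter_eq_empty_iff]
      intro i _ hi
      exact h ⟨i, hi⟩
    simp [hJ, this]
  · have : J.card ≤ T.card := Finset.card_image_le
    have h2 : hamming x = T.card := by
      rw [hT, hamming]
    rw [h2]
    exact_mod_cast this
  · have := Finset.card_le_card hJN
    rw [Finset.card_range] at this
    exact_mod_cast this

lemma core (d k K N : ℕ) (hK : 2 ≤ K) (hN : 0 < N) (hkK : k ≤ K ∨ N ≤ K) :
    ∃ c : Finset (Fin d) → ℝ,
      (∀ x ∈ cube d, hamming x ≤ k → |evalPoly c x - ORd x| ≤ 1 / 400) ∧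
      weight c ≤ (9 + 24 * (N / K : ℝ)) ^ (21 * Real.sqrt K) ∧
      (polyDegree c : ℝ) ≤ 21 * Real.sqrt K * (d / N + 1) := by
  have hK' : (2 : ℝ) ≤ K := by exact_mod_cast hK
  have hN' : (1 : ℝ) ≤ N := by exact_mod_cast hN
  have hsK : 1 ≤ Real.sqrt K := by
    rw [Real.one_le_sqrt]
    linarith
  have hsq : Real.sqrt K * Real.sqrt K = K := Real.mul_self_sqrt (by linarith)
  set m := ⌈20 * Real.sqrt K⌉₊ with hm
  have hm1 : 20 * Real.sqrt K ≤ m := Nat.le_ceil _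
  have hm2 : (m : ℝ) ≤ 21 * Real.sqrt K := by
    have := Nat.ceil_lt_add_one (a := 20 * Real.sqrt K) (by positivity)
    linarith
  have hmpos : 1 ≤ m := by
    have : (1 : ℝ) ≤ m := by linarith
    exact_mod_cast this
  set z : ℝ → ℝ := fun t => (K + 1) / (K - 1) + (-(2 / (K - 1))) * t with hz
  set T0 := cheb (z 0) m with hT0
  have hKm : (0 : ℝ) < K - 1 := by linarith
  have hz0 : z 0 = 1 + 2 / (K - 1) := by
    simp only [hz]
    field_simp
    ring
  have hT0' : 800 ≤ T0 := by
    have h1 : 1 ≤ z 0 := by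
      rw [hz0]
      have : 0 ≤ 2 / ((K : ℝ) - 1) := by positivity
      linarith
    have h2 := (cheb_large (z 0) h1 m).1
    have h3 : 800 ≤ (m : ℝ) ^ 2 * (z 0 - 1) := by
      have e : z 0 - 1 = 2 / (K - 1) := by rw [hz0]; ring
      rw [e, mul_div_assoc', le_div_iff₀ hKm]
      nlinarith
    linarith
  have hzrep : PRep (fun x => z (blk d N x)) (3 + 8 * (N / K : ℝ)) (d / N + 1) := by
    have := (rep_const (d := d) (((K : ℝ) + 1) / (K - 1))).add ((blk_rep d N).smul (-(2 / ((K : ℝ) - 1))))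
    refine this.mono ?_ (by simp)
    rw [abs_neg, abs_of_pos (by positivity), abs_of_pos (by positivity)]
    have : ((K : ℝ) + 1) / (K - 1) ≤ 3 := by
      rw [div_le_iff₀ hKm]; linarith
    have : 2 / ((K : ℝ) - 1) * (N * 2) ≤ 8 * (N / K) := by
      rw [div_mul_eq_mul_div, div_le_iff₀ hKm]
      have : 8 * ((N : ℝ) / K) * (K - 1) = 4 * N * (2 * (K - 1) / K) := by
        field_simp
        ring
      rw [this]
      have : 1 ≤ 2 * ((K : ℝ) - 1) / K := by
        rw [le_div_iff₀ (by linarith)]; linarith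
      nlinarith
    linarith
  have hNK : 0 ≤ (N / K : ℝ) := by positivity
  have hW := (rep_cheb hzrep (by linarith) m).1
  have hQ := (hW.smul (2 / T0)).add (rep_const (d := d) (-1))
  obtain ⟨c, h1, h2, h3⟩ := hQ
  refine ⟨c, ?_, ?_, ?_⟩
  · intro x hx hk
    rw [h1 x hx]
    beta_reduce
    obtain ⟨v1, v2, v3, v4⟩ := blk_val d N hN x hx
    by_cases hex : ∃ i, x i = -1
    · rw [ORd, if_pos hex]
      have t1 := v1 hex
      have t2 : blk d N x ≤ K := by
        rcases hkK with h | h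
        · refine v3.trans ?_
          exact_mod_cast hk.trans h
        · refine v4.trans ?_
          exact_mod_cast h
      have hzz : |z (blk d N x)| ≤ 1 := by
        have e : z (blk d N x) = (K + 1 - 2 * blk d N x) / (K - 1) := by
          simp only [hz]
          field_simp
          ring
        rw [e, abs_le]
        constructor
        · rw [le_div_iff₀ hKm]; linarith
        · rw [div_le_iff₀ hKm]; linarith
      have hc := cheb_abs _ hzz m
      have e : 2 / T0 * cheb (z (blk d N x)) m + -1 - -1 = 2 / T0 * cheb (z (blk d N x)) m := by
        ring
      rw [e, abs_mul, abs_of_pos (by positivity)]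
      have : 2 / T0 ≤ 1 / 400 := by
        rw [div_le_div_iff₀ (by linarith) (by norm_num)]; linarith
      have h0 : 0 ≤ 2 / T0 := by positivity
      calc 2 / T0 * |cheb (z (blk d N x)) m| ≤ 2 / T0 * 1 := mul_le_mul_of_nonneg_left hc h0
        _ ≤ 1 / 400 := by linarith
    · rw [ORd, if_neg hex, v2 hex, ← hT0]
      have : 2 / T0 * T0 = 2 := by
        field_simp
      rw [this]
      norm_num
  · refine h2.trans ?_
    have hbase : 3 * (3 + 8 * (N / K : ℝ)) = 9 + 24 * (N / K) := by ring
    rw [hbase]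
    set B := 9 + 24 * (N / K : ℝ) with hB
    have hB9 : 9 ≤ B := by linarith
    have hBm : 9 ≤ B ^ m := hB9.trans (le_self_pow₀ (by linarith) (by omega))
    rw [abs_of_pos (by positivity)]
    have : 2 / T0 ≤ 1 / 400 := by
      rw [div_le_div_iff₀ (by linarith) (by norm_num)]; linarith
    calc 2 / T0 * B ^ m + |(-1 : ℝ)| ≤ 1 / 400 * B ^ m + 1 := by
          have := mul_le_mul_of_nonneg_right this (by positivity : 0 ≤ B ^ m)
          norm_num at this ⊢
          linarith
      _ ≤ B ^ m := by linarith
      _ = B ^ (m : ℝ) := (Real.rpow_natCast _ _).symm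
      _ ≤ _ := Real.rpow_le_rpow_of_exponent_le (by linarith) hm2
  · have hd : polyDegree c ≤ m * (d / N + 1) := by
      unfold polyDegree
      refine Finset.sup_le fun S hS => ?_
      simp only [Finset.mem_filter, Finset.mem_univ, true_and] at hS
      simpa using h3 S hS
    have hd' : (polyDegree c : ℝ) ≤ (m : ℝ) * (((d / N : ℕ) : ℝ) + 1) := by exact_mod_cast hd
    have h4 : ((d / N : ℕ) : ℝ) ≤ d / N := Nat.cast_div_le
    refine hd'.trans ?_
    gcongr

lemma asym : ∃ L0 : ℝ, 1 ≤ L0 ∧ ∀ L : ℝ, L0 ≤ L →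
    Real.exp 10 ≤ L ^ (0.995 : ℝ) ∧ 21 * 51 * 4 * L ^ (0.995 : ℝ) ≤ 0.01 * L ∧
      50 * L ≤ Real.exp (L / 2) := by
  have a1 : ∀ᶠ L : ℝ in Filter.atTop, Real.exp 10 ≤ L ^ (0.995 : ℝ) :=
    (tendsto_rpow_atTop (by norm_num)).eventually_ge_atTop _
  have a2 : ∀ᶠ L : ℝ in Filter.atTop, 428400 ≤ L ^ (0.005 : ℝ) :=
    (tendsto_rpow_atTop (by norm_num)).eventually_ge_atTop _
  have a3 := Filter.eventually_ge_atTop (400 : ℝ)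
  obtain ⟨L0, h⟩ := Filter.eventually_atTop.mp (a1.and (a2.and a3))
  refine ⟨max L0 1, le_max_right _ _, fun L hL => ?_⟩
  obtain ⟨h1, h2, h3⟩ := h L ((le_max_left _ _).trans hL)
  refine ⟨h1, ?_, ?_⟩
  · have e : L = L ^ (0.995 : ℝ) * L ^ (0.005 : ℝ) := by
      rw [← Real.rpow_add (by linarith)]
      norm_num
    have h0 : 0 ≤ L ^ (0.995 : ℝ) := by positivity
    nlinarith [mul_le_mul_of_nonneg_left h2 h0]
  · have := Real.quadratic_le_exp_of_nonneg (x := L / 2) (by linarith)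
    nlinarith

lemma log_bd {x y : ℝ} (hx : 0 < x) (n : ℕ) (h : x ≤ 2 ^ n) (hy : n * 0.7 ≤ y) :
    Real.log x ≤ y := by
  have h1 := Real.log_le_log hx h
  rw [Real.log_pow] at h1
  have := Real.log_two_lt_d9
  have : (n : ℝ) * Real.log 2 ≤ n * 0.7 := by
    gcongr
    linarith
  linarith

lemma caseB (d k : ℕ) (L S : ℝ) (hL : 1 ≤ L) (hd : (d : ℝ) = Real.exp L) (hS : 1 ≤ S) (hSL : S ≤ L)
    (h2 : 21 * 51 * 4 * S ≤ 0.01 * L) (h3 : 50 * L ≤ Real.exp (L / 2)) :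
    ∃ c : Finset (Fin d) → ℝ,
      (∀ x ∈ cube d, hamming x ≤ k → |evalPoly c x - ORd x| ≤ 1 / 400) ∧
      weight c ≤ (d : ℝ) ^ (0.01 : ℝ) ∧ (polyDegree c : ℝ) ≤ d / S := by
  set N := ⌈(50 * S) ^ 2⌉₊ with hN
  have n1 : (50 * S) ^ 2 ≤ N := Nat.le_ceil _
  have n2 : (N : ℝ) ≤ (50 * S) ^ 2 + 1 := (Nat.ceil_lt_add_one (by positivity)).le
  have n3 : (2 : ℝ) ≤ N := by nlinarith
  have n4 : 2 ≤ N := by exact_mod_cast n3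
  have s1 : 50 * S ≤ Real.sqrt N := Real.le_sqrt_of_sq_le n1
  have s2 : Real.sqrt N ≤ 51 * S := by
    rw [Real.sqrt_le_left (by positivity)]
    nlinarith
  have hsq : Real.sqrt N * Real.sqrt N = N := Real.mul_self_sqrt (by linarith)
  obtain ⟨c, c1, c2, c3⟩ := core d k N N n4 (by omega) (Or.inr le_rfl)
  refine ⟨c, c1, c2.trans ?_, c3.trans ?_⟩
  · rw [div_self (by linarith), hd, ← Real.exp_mul, Real.rpow_def_of_pos (by norm_num)]
    rw [Real.exp_le_exp]
    have hl : Real.log (9 + 24 * 1) ≤ 4 := by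
      have h0 : (9 + 24 * 1 : ℝ) = 2 ^ 5 * (33 / 32) := by norm_num
      rw [h0, Real.log_mul (by norm_num) (by norm_num), Real.log_pow]
      have h11 := Real.log_le_sub_one_of_pos (x := 33 / 32) (by norm_num)
      have := Real.log_two_lt_d9
      push_cast
      generalize Real.log (33 / 32) = u at *
      linarith
    calc Real.log (9 + 24 * 1) * (21 * Real.sqrt N) ≤ 4 * (21 * (51 * S)) := by gcongr
      _ ≤ L * 0.01 := by linarith
  · have hs0 : 0 < Real.sqrt N := by linarith
    have e1 : 21 * Real.sqrt N * (d / N + 1) = 21 * (d / Real.sqrt N) + 21 * Real.sqrt N := by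
      rw [← hsq, Real.sqrt_mul_self hs0.le]
      field_simp
    rw [e1]
    have e2 : (d : ℝ) / Real.sqrt N ≤ d / (50 * S) := by gcongr
    have e3 : (d : ℝ) / (50 * S) = d / S / 50 := by field_simp
    have e4 : 2500 * L ^ 2 ≤ d := by
      have : (d : ℝ) = Real.exp (L / 2) * Real.exp (L / 2) := by
        rw [hd, ← Real.exp_add]
        ring_nf
      rw [this]
      nlinarith
    have e5 : 2500 * S ≤ d / S := by
      rw [le_div_iff₀ (by linarith)]
      nlinarith
    linarith

lemma caseA (d k : ℕ) (hk : 1 ≤ k) (L R : ℝ) (hL : 1 ≤ L) (hd : (d : ℝ) = Real.exp L)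
    (hR : R = Real.exp (L / (6400 * Real.sqrt k))) (hR10 : Real.exp 10 ≤ R)
    (h3 : 50 * L ≤ Real.exp (L / 2)) :
    ∃ c : Finset (Fin d) → ℝ,
      (∀ x ∈ cube d, hamming x ≤ k → |evalPoly c x - ORd x| ≤ 1 / 400) ∧
      weight c ≤ (d : ℝ) ^ (0.01 : ℝ) ∧ (polyDegree c : ℝ) ≤ d / R := by
  have hk1 : (1 : ℝ) ≤ k := by exact_mod_cast hk
  have hsk : 1 ≤ Real.sqrt k := by rwa [Real.one_le_sqrt]
  have hskq : Real.sqrt k * Real.sqrt k = k := Real.mul_self_sqrt (by linarith)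
  set K := k + 1 with hK
  have hKr : (K : ℝ) = k + 1 := by simp [hK]
  have hsK : 1 ≤ Real.sqrt K := by
    rw [Real.one_le_sqrt]; linarith
  have hsKk : Real.sqrt K ≤ 1.5 * Real.sqrt k := by
    rw [Real.sqrt_le_left (by positivity)]
    nlinarith
  have hsq : Real.sqrt K * Real.sqrt K = K := Real.mul_self_sqrt (by linarith)
  have hlog : 10 ≤ L / (6400 * Real.sqrt k) := by
    rw [hR] at hR10
    exact Real.exp_le_exp.mp hR10
  have hkL : 64000 * Real.sqrt k ≤ L := by
    rw [le_div_iff₀ (by positivity)] at hlog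
    linarith
  have hR1 : 1 ≤ R := le_trans (by simp) hR10
  have hR2 : R ≤ Real.exp (L / 2) := by
    rw [hR, Real.exp_le_exp]
    apply div_le_div_of_nonneg_left <;> linarith
  set N := ⌈50 * Real.sqrt K * R⌉₊ with hN
  have hKR : 1 ≤ Real.sqrt K * R := by nlinarith
  have n1 : 50 * Real.sqrt K * R ≤ N := Nat.le_ceil _
  have n2 : (N : ℝ) ≤ 51 * Real.sqrt K * R := by
    have := (Nat.ceil_lt_add_one (a := 50 * Real.sqrt K * R) (by positivity)).le
    linarith
  have n3 : (0 : ℝ) < N := by linarith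
  have n4 : 0 < N := by exact_mod_cast n3
  obtain ⟨c, c1, c2, c3⟩ := core d k K N (by omega) n4 (Or.inl (by omega))
  refine ⟨c, c1, c2.trans ?_, c3.trans ?_⟩
  · have hNK : (N : ℝ) / K ≤ 51 * R := by
      rw [div_le_iff₀ (by linarith)]
      calc (N : ℝ) ≤ 51 * Real.sqrt K * R := n2
        _ ≤ 51 * (Real.sqrt K * Real.sqrt K) * R := by
          gcongr
          nlinarith
        _ = 51 * R * K := by rw [hsq]; ring
    have hb : 9 + 24 * (N / K : ℝ) ≤ 1233 * R := by linarith
    have hb0 : 0 < 9 + 24 * (N / K : ℝ) := by positivity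
    rw [hd, ← Real.exp_mul, Real.rpow_def_of_pos hb0, Real.exp_le_exp]
    have hl : Real.log (9 + 24 * (N / K : ℝ)) ≤ 7.7 + L / (6400 * Real.sqrt k) := by
      refine (Real.log_le_log hb0 hb).trans ?_
      rw [Real.log_mul (by norm_num) (by linarith), hR, Real.log_exp]
      have := log_bd (x := 1233) (y := 7.7) (by norm_num) 11 (by norm_num) (by norm_num)
      linarith
    calc Real.log (9 + 24 * (N / K : ℝ)) * (21 * Real.sqrt K)
        ≤ (7.7 + L / (6400 * Real.sqrt k)) * (21 * (1.5 * Real.sqrt k)) := by gcongr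
      _ = 242.55 * Real.sqrt k + 31.5 / 6400 * L := by
        field_simp
        ring
      _ ≤ L * 0.01 := by linarith
  · have e1 : 21 * Real.sqrt K * (d / N + 1) ≤ 21 * Real.sqrt K * (d / (50 * Real.sqrt K * R) + 1) := by
      gcongr
    have e2 : 21 * Real.sqrt K * (d / (50 * Real.sqrt K * R) + 1) = 21 / 50 * (d / R) + 21 * Real.sqrt K := by
      field_simp
    have e3 : 50 * L ≤ d / R := by
      rw [le_div_iff₀ (by linarith)]
      have : (d : ℝ) = Real.exp (L / 2) * Real.exp (L / 2) := by
        rw [hd, ← Real.exp_add]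
        ring_nf
      rw [this]
      gcongr
    linarith

theorem stmt_7 : ∃ C > (0 : ℝ), ∀ d k : ℕ, 1 ≤ k → k ≤ d → C ≤ (d : ℝ) →
    ∃ c : Finset (Fin d) → ℝ,
      (∀ x ∈ cube d, hamming x ≤ k → |evalPoly c x - ORd x| ≤ 1 / 400) ∧
      weight c ≤ (d : ℝ) ^ (0.01 : ℝ) ∧
      (polyDegree c : ℝ) ≤
        min ((d : ℝ) ^ (1 - 1 / (C * Real.sqrt k)))
            ((d : ℝ) / Real.log d ^ (0.995 : ℝ)) := by
  obtain ⟨L0, hL0, hA⟩ := asym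
  refine ⟨max 6400 (Real.exp L0), by positivity, ?_⟩
  intro d k hk hkd hCd
  have hk1 : (1 : ℝ) ≤ k := by exact_mod_cast hk
  have hsk : 1 ≤ Real.sqrt k := by rwa [Real.one_le_sqrt]
  have hdL : Real.exp L0 ≤ d := (le_max_right _ _).trans hCd
  have hd0 : (0 : ℝ) < d := (Real.exp_pos _).trans_le hdL
  have hd1 : (1 : ℝ) ≤ d := by
    have := (le_max_left (6400 : ℝ) (Real.exp L0)).trans hCd
    linarith
  set L := Real.log d with hL
  have hLL : L0 ≤ L := (Real.le_log_iff_exp_le hd0).mpr hdL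
  have hd : (d : ℝ) = Real.exp L := (Real.exp_log hd0).symm
  obtain ⟨h1, h2, h3⟩ := hA L hLL
  have hL1 : 1 ≤ L := hL0.trans hLL
  set S := L ^ (0.995 : ℝ) with hS
  have hS1 : 1 ≤ S := le_trans (by simp) h1
  have hSL : S ≤ L := by
    calc S ≤ L ^ (1 : ℝ) := Real.rpow_le_rpow_of_exponent_le hL1 (by norm_num)
      _ = L := Real.rpow_one L
  set R := Real.exp (L / (6400 * Real.sqrt k)) with hR
  have hR0 : 0 < R := Real.exp_pos _
  have hdR : (d : ℝ) / R ≤ (d : ℝ) ^ (1 - 1 / (max 6400 (Real.exp L0) * Real.sqrt k)) := by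
    have e : (d : ℝ) / R = (d : ℝ) ^ (1 - 1 / (6400 * Real.sqrt k)) := by
      rw [hd, ← Real.exp_mul, hR, ← Real.exp_sub]
      congr 1
      ring
    rw [e]
    apply Real.rpow_le_rpow_of_exponent_le hd1
    have : 1 / (max 6400 (Real.exp L0) * Real.sqrt k) ≤ 1 / (6400 * Real.sqrt k) := by
      gcongr
      exact le_max_left _ _
    linarith
  rcases le_total S R with hSR | hRS
  · obtain ⟨c, c1, c2, c3⟩ := caseA d k hk L R hL1 hd hR (h1.trans hSR) h3
    refine ⟨c, c1, c2, le_min (c3.trans hdR) (c3.trans ?_)⟩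
    gcongr
  · obtain ⟨c, c1, c2, c3⟩ := caseB d k L S hL1 hd hS1 hSL h2 h3
    refine ⟨c, c1, c2, le_min (c3.trans (le_trans ?_ hdR)) c3⟩
    gcongr
end

section
/- There exists a universal constant C > 0 such that for every k ∈ [d] and every W ≤ (1/6)·2^{−k}·(d/k)^{C√k}, any d-variate polynomial of weight at most W that approximates OR_d to within 1/6 pointwise on all inputs of Hamming weight at most k must have degree Ω((d/√k)·W^{−1/(C√k)}/2^{√k/C}). -/
open Finset Polynomial in
lemma lower_prod (a n : ℕ) (hn : n ≤ a) :
    (∏ j ∈ range n, ((j:ℝ)+1)^2 / (((a:ℝ)+1)^2 - ((j:ℝ)+1)^2)) * ((a+1+n).factorial * (a.factorial))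
      = (n.factorial : ℝ)^2 * (a-n).factorial * (a+1).factorial := by
  induction n with
  | zero => simp; ring
  | succ n ih =>
    obtain ⟨b, rfl⟩ : ∃ b, a = n + 1 + b := ⟨a - (n+1), by omega⟩
    have ih := ih (by omega)
    rw [prod_range_succ]
    have e1 : n + 1 + b - n = b + 1 := by omega
    have e2 : n + 1 + b - (n+1) = b := by omega
    rw [e1] at ih
    rw [e2]
    have e3 : ((n+1+b+1+(n+1)).factorial : ℝ) = (n+1+b+1+(n+1) : ℝ) * ((n+1+b+1+n).factorial : ℝ) := by
      rw [show n+1+b+1+(n+1) = (n+1+b+1+n)+1 by ring, Nat.factorial_succ]; push_cast; ring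
    have e4 : ((b+1).factorial : ℝ) = (b+1:ℝ) * (b.factorial:ℝ) := by
      rw [Nat.factorial_succ]; push_cast; ring
    have e5 : ((n+1).factorial : ℝ) = (n+1:ℝ) * (n.factorial:ℝ) := by
      rw [Nat.factorial_succ]; push_cast; ring
    rw [e4] at ih
    rw [e3, e5]
    have hb : (b:ℝ)+1 ≠ 0 := by positivity
    have hd : (((n + 1 + b : ℕ):ℝ)+1)^2 - ((n:ℝ)+1)^2 = (b+1) * (n+1+b+1+(n+1)) := by push_cast; ring
    have hd2 : (n+1+b+1+(n+1) : ℝ) ≠ 0 := by positivity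
    set P := ∏ j ∈ range n, ((j:ℝ)+1)^2 / ((((n + 1 + b : ℕ):ℝ)+1)^2 - ((j:ℝ)+1)^2)
    rw [hd]
    field_simp
    linear_combination ih

open Finset in
lemma upper_prod (a n : ℕ) :
    (∏ j ∈ range n, ((a:ℝ)+2+j)^2 / (((a:ℝ)+2+j)^2 - ((a:ℝ)+1)^2)) *
        ((a+1).factorial^2 * n.factorial * (2*a+2+n).factorial)
      = ((a+1+n).factorial : ℝ)^2 * (2*a+2).factorial := by
  induction n with
  | zero => simp
  | succ n ih =>
    rw [prod_range_succ]
    have e3 : ((a+1+(n+1)).factorial : ℝ) = (a+2+n : ℝ) * ((a+1+n).factorial : ℝ) := by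
      rw [show a+1+(n+1) = (a+1+n)+1 by ring, Nat.factorial_succ]; push_cast; ring
    have e4 : ((2*a+2+(n+1)).factorial : ℝ) = (2*a+2+n+1:ℝ) * ((2*a+2+n).factorial:ℝ) := by
      rw [show 2*a+2+(n+1) = (2*a+2+n)+1 by ring, Nat.factorial_succ]; push_cast; ring
    have e5 : ((n+1).factorial : ℝ) = (n+1:ℝ) * (n.factorial:ℝ) := by
      rw [Nat.factorial_succ]; push_cast; ring
    rw [e3, e4, e5]
    have hd : ((a:ℝ)+2+n)^2 - ((a:ℝ)+1)^2 = (n+1) * (2*a+2+n+1) := by ring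
    have hd1 : (n+1:ℝ) ≠ 0 := by positivity
    have hd2 : (2*a+2+n+1 : ℝ) ≠ 0 := by positivity
    rw [hd]
    set P := ∏ j ∈ range n, ((a:ℝ)+2+j)^2 / (((a:ℝ)+2+j)^2 - ((a:ℝ)+1)^2)
    field_simp
    linear_combination ih

lemma fact_ineq (i n : ℕ) : (n+i).factorial^2 ≤ n.factorial * (2*i+n).factorial := by
  have h1 := Nat.add_choose_mul_factorial_mul_factorial n (2*i+n)
  have h2 := Nat.add_choose_mul_factorial_mul_factorial (n+i) (n+i)
  have h3 := Nat.choose_le_centralBinom (2*i+n) (n+i)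
  rw [Nat.centralBinom] at h3
  rw [show n + (2*i+n) = 2*(n+i) by ring] at h1
  rw [show n+i + (n+i) = 2*(n+i) by ring] at h2
  have h4 : 0 < (2*(n+i)).choose (n+i) := Nat.choose_pos (by omega)
  refine Nat.le_of_mul_le_mul_left ?_ h4
  calc _ = (2*(n+i)).factorial := by rw [← h2]; ring
    _ = (2*(n+i)).choose (2*i+n) * (n.factorial * (2*i+n).factorial) := by rw [← h1]; ring
    _ ≤ _ := Nat.mul_le_mul_right _ h3

open Finset in
lemma both_prod (a n : ℕ) :
    (∏ j ∈ range a, ((j:ℝ)+1)^2 / (((a:ℝ)+1)^2 - ((j:ℝ)+1)^2)) *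
    (∏ j ∈ range n, ((a:ℝ)+2+j)^2 / (((a:ℝ)+2+j)^2 - ((a:ℝ)+1)^2)) ≤ 2 := by
  have h1 := lower_prod a a le_rfl
  have h2 := upper_prod a n
  have h3 : ((n+(a+1)).factorial:ℝ)^2 ≤ n.factorial * (2*(a+1)+n).factorial := by
    exact_mod_cast fact_ineq (a+1) n
  set P := ∏ j ∈ range a, ((j:ℝ)+1)^2 / (((a:ℝ)+1)^2 - ((j:ℝ)+1)^2)
  set Q := ∏ j ∈ range n, ((a:ℝ)+2+j)^2 / (((a:ℝ)+2+j)^2 - ((a:ℝ)+1)^2)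
  rw [show n + (a+1) = a+1+n by ring, show 2*(a+1)+n = 2*a+2+n by ring] at h3
  have e1 : ((2*a+2).factorial:ℝ) = (2*a+2:ℝ) * ((a+1+a).factorial:ℝ) := by
    rw [show 2*a+2 = (a+1+a)+1 by ring, Nat.factorial_succ]; push_cast; ring
  have e2 : ((a+1).factorial:ℝ) = (a+1:ℝ) * (a.factorial:ℝ) := by
    rw [Nat.factorial_succ]; push_cast; ring
  rw [e1, e2] at h2
  rw [e2] at h1
  simp only [Nat.sub_self, Nat.factorial_zero, Nat.cast_one] at h1
  have pa : (0:ℝ) < a.factorial := by positivity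
  have pb : (0:ℝ) < (a+1+a).factorial := by positivity
  have pn : (0:ℝ) < n.factorial * (2*a+2+n).factorial := by positivity
  have p1 : (0:ℝ) < a + 1 := by positivity
  have h1' : P * (a+1+a).factorial = (a+1) * a.factorial^2 := by
    apply mul_right_cancel₀ pa.ne'; linear_combination h1
  have key : P * Q * (n.factorial * (2*a+2+n).factorial) = 2 * (a+1+n).factorial^2 := by
    have : ((a+1)^2 * a.factorial^2 * (a+1+a).factorial : ℝ) ≠ 0 := by positivity
    apply mul_right_cancel₀ this
    linear_combination P * (a+1+a).factorial * h2 + 2 * (a+1) * (a+1+a).factorial * (a+1+n).factorial^2 * h1'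
  by_contra! hc
  nlinarith

/-- interpolation nodes -/
noncomputable def nodeV (j : ℕ) : ℝ := if j = 0 then 1 else 16 * (j:ℝ)^2

open Finset in
lemma node_prod (a n : ℕ) :
    |∏ j ∈ (range (a+1+n+1)).erase (a+1), (0 - nodeV j) / (nodeV (a+1) - nodeV j)|
      ≤ 2 / (16 * ((a:ℝ)+1)^2 - 1) := by
  have e : ∏ j ∈ (range (a+1+n+1)).erase (a+1), (0 - nodeV j) / (nodeV (a+1) - nodeV j)
      = ∏ j ∈ range (a+1+n+1), if j = a+1 then 1 else (0 - nodeV j) / (nodeV (a+1) - nodeV j) := by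
    rw [← Finset.mul_prod_erase (range (a+1+n+1)) _ (show a+1 ∈ range (a+1+n+1) by simp)]
    simp only [if_true, one_mul]
    refine prod_congr rfl fun j hj => ?_
    rw [if_neg (ne_of_mem_erase hj)]
  rw [e, show a+1+n+1 = a+1+1+n by ring, prod_range_add, prod_range_succ, prod_range_succ', abs_mul,
    abs_mul, abs_mul, abs_prod, abs_prod]
  have l1 : ∏ j ∈ range a, |if j + 1 = a+1 then 1 else (0 - nodeV (j+1)) / (nodeV (a+1) - nodeV (j+1))|
      = ∏ j ∈ range a, ((j:ℝ)+1)^2 / (((a:ℝ)+1)^2 - ((j:ℝ)+1)^2) := by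
    refine prod_congr rfl fun j hj => ?_
    have hj' : j < a := mem_range.mp hj
    have hjr : (j:ℝ) + 1 ≤ a := by exact_mod_cast hj'
    have hj0 : (0:ℝ) ≤ j := by positivity
    rw [if_neg (by omega)]
    have hp : 0 < ((a:ℝ)+1)^2 - ((j:ℝ)+1)^2 := by nlinarith
    simp only [nodeV, Nat.succ_ne_zero, if_false]
    push_cast
    rw [show (16 * ((a:ℝ)+1)^2 - 16 * ((j:ℝ)+1)^2) = 16 * (((a:ℝ)+1)^2 - ((j:ℝ)+1)^2) by ring,
      zero_sub, neg_div, abs_neg, mul_div_mul_left _ _ (by norm_num : (16:ℝ) ≠ 0), abs_of_pos]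
    positivity
  have l2 : ∏ j ∈ range n, |if a + 1 + 1 + j = a+1 then 1 else
        (0 - nodeV (a + 1 + 1 + j)) / (nodeV (a+1) - nodeV (a + 1 + 1 + j))|
      = ∏ j ∈ range n, ((a:ℝ)+2+j)^2 / (((a:ℝ)+2+j)^2 - ((a:ℝ)+1)^2) := by
    refine prod_congr rfl fun j hj => ?_
    have hj0 : (0:ℝ) ≤ j := by positivity
    have ha0 : (0:ℝ) ≤ a := by positivity
    rw [if_neg (by omega)]
    have hp : 0 < ((a:ℝ)+2+j)^2 - ((a:ℝ)+1)^2 := by nlinarith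
    have hz : a + 1 + 1 + j ≠ 0 := by omega
    simp only [nodeV, Nat.succ_ne_zero, if_false, hz]
    push_cast
    rw [show (16 * ((a:ℝ)+1)^2 - 16 * ((a:ℝ)+1+1+j)^2) = - (16 * (((a:ℝ)+2+j)^2 - ((a:ℝ)+1)^2)) by ring,
      zero_sub, neg_div_neg_eq, mul_div_mul_left _ _ (by norm_num : (16:ℝ) ≠ 0), abs_of_pos]
    · congr 1; ring
    · rw [show (a:ℝ)+1+1+j = a+2+j by ring]; positivity
  have l3 : |if 0 = a+1 then 1 else (0 - nodeV 0) / (nodeV (a+1) - nodeV 0)| = 1 / (16 * ((a:ℝ)+1)^2 - 1) := by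
    have ha0 : (0:ℝ) ≤ a := by positivity
    have hp : 0 < 16 * ((a:ℝ)+1)^2 - 1 := by nlinarith
    rw [if_neg (by omega)]
    simp only [nodeV, Nat.succ_ne_zero, if_false, if_true]
    push_cast
    rw [zero_sub, neg_div, abs_neg, abs_of_pos]
    positivity
  rw [l1, l2, l3, if_pos rfl, abs_one, mul_one]
  have ha0 : (0:ℝ) ≤ a := by positivity
  have hp : 0 < 16 * ((a:ℝ)+1)^2 - 1 := by nlinarith
  have := both_prod a n
  rw [mul_right_comm, mul_one_div]
  gcongr

open Finset in
lemma sum_bound (m : ℕ) : ∑ a ∈ range m, 2 / (16 * ((a:ℝ)+1)^2 - 1) ≤ (4/15) * (1 - 1/((m:ℝ)+1)) := by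
  induction m with
  | zero => simp
  | succ m ih =>
    rw [sum_range_succ]
    have hm : (0:ℝ) ≤ m := by positivity
    have hp : 0 < 16 * ((m:ℝ)+1)^2 - 1 := by nlinarith
    have : 2 / (16 * ((m:ℝ)+1)^2 - 1) ≤ (4/15) * (1/((m:ℝ)+1) - 1/((m:ℝ)+2)) := by
      rw [div_sub_div _ _ (by positivity) (by positivity), div_mul_div_comm, div_le_div_iff₀ hp (by positivity)]
      nlinarith
    push_cast
    rw [show (m:ℝ)+1+1 = m+2 by ring]
    linarith

open Finset Polynomial in
lemma no_poly (m : ℕ) (r : ℝ[X]) (hdeg : r.natDegree ≤ m) (h0 : |r.eval 0 - 1| ≤ 1/3)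
    (h : ∀ j ≤ m, |r.eval (nodeV j) + 1| ≤ 1/3) : False := by
  have hinj : Set.InjOn nodeV (range (m+1) : Finset ℕ) := by
    intro i _ j _ hij
    unfold nodeV at hij
    split_ifs at hij with h1 h2 h2
    · omega
    · exfalso
      have : (1:ℝ) ≤ j := by exact_mod_cast Nat.one_le_iff_ne_zero.mpr h2
      nlinarith
    · exfalso
      have : (1:ℝ) ≤ i := by exact_mod_cast Nat.one_le_iff_ne_zero.mpr h1
      nlinarith
    · have : (i:ℝ)^2 = (j:ℝ)^2 := by linarith
      have := (sq_eq_sq₀ (Nat.cast_nonneg i) (Nat.cast_nonneg j)).mp this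
      exact_mod_cast this
  have hd : r.degree < #(range (m+1)) := by
    rw [card_range]
    exact lt_of_le_of_lt degree_le_natDegree (by exact_mod_cast Nat.lt_succ_of_le hdeg)
  have e := congrArg (eval 0) (Lagrange.eq_interpolate hinj hd)
  rw [Lagrange.interpolate_apply, eval_finsetSum] at e
  have eb : ∀ i, (Lagrange.basis (range (m+1)) nodeV i).eval 0
      = ∏ j ∈ (range (m+1)).erase i, (0 - nodeV j) / (nodeV i - nodeV j) := by
    intro i
    rw [Lagrange.basis, eval_prod]
    refine prod_congr rfl fun j _ => ?_
    simp [Lagrange.basisDivisor]; ring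
  simp only [eval_mul, eval_C, eb] at e
  rw [sum_range_succ'] at e
  have t1 : ∑ i ∈ range m, eval (nodeV (i+1)) r *
      ∏ j ∈ (range (m+1)).erase (i+1), (0 - nodeV j) / (nodeV (i+1) - nodeV j) ≤ 16/45 := by
    calc _ ≤ ∑ i ∈ range m, (4/3) * (2 / (16 * ((i:ℝ)+1)^2 - 1)) := by
          refine sum_le_sum fun i hi => ?_
          obtain ⟨n, rfl⟩ : ∃ n, m = i + 1 + n := ⟨m - (i+1), by have := mem_range.mp hi; omega⟩
          refine (le_abs_self _).trans ?_
          rw [abs_mul]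
          have h1 := h (i+1) (by omega)
          rw [abs_le] at h1
          have h2 : |eval (nodeV (i+1)) r| ≤ 4/3 := by rw [abs_le]; constructor <;> linarith
          exact mul_le_mul h2 (node_prod i n) (abs_nonneg _) (by norm_num)
      _ ≤ _ := by
          rw [← mul_sum]
          have := sum_bound m
          have h5 : (0:ℝ) ≤ 1 / ((m:ℝ)+1) := by positivity
          linarith
  have t2 : eval (nodeV 0) r * ∏ j ∈ (range (m+1)).erase 0, (0 - nodeV j) / (nodeV 0 - nodeV j) ≤ 0 := by
    apply mul_nonpos_of_nonpos_of_nonneg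
    · have := h 0 (by omega)
      rw [abs_le] at this; linarith
    · refine prod_nonneg fun j hj => ?_
      have hj0 := ne_of_mem_erase hj
      have : (1:ℝ) ≤ j := by exact_mod_cast Nat.one_le_iff_ne_zero.mpr hj0
      simp only [nodeV, if_true, hj0, if_false]
      apply div_nonneg_of_nonpos <;> nlinarith
  rw [abs_le] at h0
  linarith

/-- the cube point with `-1` exactly on `T` -/
noncomputable def ptOf {d : ℕ} (T : Finset (Fin d)) (i : Fin d) : ℝ := if i ∈ T then -1 else 1

lemma ptOf_eq_iff {d : ℕ} (T : Finset (Fin d)) (i : Fin d) : ptOf T i = -1 ↔ i ∈ T := by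
  unfold ptOf; split_ifs with h
  · simp [h]
  · simp only [h, iff_false]; norm_num

lemma ptOf_mem {d : ℕ} (T : Finset (Fin d)) : ptOf T ∈ cube d := by
  intro i; unfold ptOf; split_ifs <;> simp

lemma hamming_ptOf {d : ℕ} (T : Finset (Fin d)) : hamming (ptOf T) = T.card := by
  unfold hamming
  congr 1
  ext i
  simp [ptOf_eq_iff]

lemma OR_ptOf {d : ℕ} (T : Finset (Fin d)) : ORd (ptOf T) = if T.card = 0 then 1 else -1 := by
  unfold ORd
  simp only [ptOf_eq_iff, Finset.card_eq_zero]
  by_cases h : T = ∅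
  · simp [h]
  · rw [if_neg h, if_pos (show ∃ i, i ∈ T from Finset.nonempty_iff_ne_empty.mpr h)]

open Finset in
lemma count_sup {d : ℕ} (J : Finset (Fin d)) (t : ℕ) :
    #{T ∈ powersetCard t (univ : Finset (Fin d)) | J ⊆ T} * d.choose #J = d.choose t * t.choose #J := by
  by_cases hJ : #J ≤ t
  · have h1 : #{T ∈ powersetCard t (univ : Finset (Fin d)) | J ⊆ T} = (d - #J).choose (t - #J) := by
      have h2 : #(powersetCard (t - #J) (univ \ J)) = (d - #J).choose (t - #J) := by
        rw [card_powersetCard, card_univ_sdiff, Fintype.card_fin]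
      rw [← h2]
      refine card_bij' (fun T _ => T \ J) (fun U _ => U ∪ J) ?_ ?_ ?_ ?_
      · intro T hT
        simp only [mem_filter, mem_powersetCard] at hT
        rw [mem_powersetCard]
        exact ⟨sdiff_subset_sdiff (subset_univ _) (Subset.refl _), by rw [card_sdiff_of_subset hT.2, hT.1.2]⟩
      · intro U hU
        rw [mem_powersetCard] at hU
        simp only [mem_filter, mem_powersetCard]
        refine ⟨⟨subset_univ _, ?_⟩, subset_union_right⟩
        rw [card_union_of_disjoint, hU.2]
        · omega
        · exact (disjoint_sdiff_self_left).mono_left hU.1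
      · intro T hT
        simp only [mem_filter] at hT
        exact sdiff_union_of_subset hT.2
      · intro U hU
        rw [mem_powersetCard] at hU
        have : Disjoint U J := (disjoint_sdiff_self_left).mono_left hU.1
        exact union_sdiff_cancel_right this
    rw [h1, Nat.choose_mul hJ, mul_comm]
  · rw [Nat.choose_eq_zero_of_lt (not_le.mp hJ), mul_zero]
    have : #{T ∈ powersetCard t (univ : Finset (Fin d)) | J ⊆ T} = 0 := by
      rw [card_eq_zero, filter_eq_empty_iff]
      intro T hT hs
      rw [mem_powersetCard] at hT
      have := card_le_card hs
      omega
    rw [this, zero_mul]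

open Finset in
lemma avg_char {d : ℕ} (S : Finset (Fin d)) (t : ℕ) :
    ∑ T ∈ powersetCard t (univ : Finset (Fin d)), ∏ i ∈ S, ptOf T i
      = d.choose t * ∑ j ∈ range (d+1), (-2:ℝ)^j * ((#S).choose j / d.choose j) * t.choose j := by
  have hS : #S ≤ d := by simpa using card_le_univ S
  have h1 : ∀ T : Finset (Fin d), ∏ i ∈ S, ptOf T i
      = ∑ J ∈ S.powerset, if J ⊆ T then (-2:ℝ)^#J else 0 := by
    intro T
    have : ∀ i, ptOf T i = 1 + (if i ∈ T then (-2:ℝ) else 0) := by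
      intro i; unfold ptOf; split_ifs <;> norm_num
    simp only [this]
    rw [prod_one_add]
    refine sum_congr rfl fun J _ => ?_
    rw [prod_ite_zero, prod_const]
    rfl
  simp only [h1]
  rw [sum_comm]
  have h2 : ∀ J ∈ S.powerset, (∑ T ∈ powersetCard t (univ : Finset (Fin d)), if J ⊆ T then (-2:ℝ)^#J else 0)
      = (fun j : ℕ => (-2:ℝ)^j * (d.choose t * t.choose j / d.choose j)) #J := by
    intro J hJ
    have hJd : #J ≤ d := by simpa using card_le_univ J
    have hp : (d.choose #J : ℝ) ≠ 0 := by exact_mod_cast (Nat.choose_pos hJd).ne'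
    rw [← sum_filter, sum_const, nsmul_eq_mul, mul_comm]
    simp only
    congr 1
    rw [eq_div_iff hp]
    exact_mod_cast count_sup J t
  rw [sum_congr rfl h2, sum_powerset_apply_card (fun j : ℕ => (-2:ℝ)^j * (d.choose t * t.choose j / d.choose j)), mul_sum]
  rw [← sum_subset (range_subset_range.mpr (Nat.succ_le_succ hS))]
  · refine sum_congr rfl fun j _ => ?_
    rw [nsmul_eq_mul]; ring
  · intro j _ hj
    rw [Nat.choose_eq_zero_of_lt (show #S < j by simpa using hj)]; simp

lemma desc_ineq (s d j : ℕ) (h : s ≤ d) : s.descFactorial j * d^j ≤ s^j * d.descFactorial j := by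
  induction j with
  | zero => simp
  | succ j ih =>
    rw [Nat.descFactorial_succ, Nat.descFactorial_succ, pow_succ, pow_succ]
    have h1 : (s - j) * d ≤ s * (d - j) := by
      rw [Nat.sub_mul, Nat.mul_sub]
      have : s * j ≤ j * d := by rw [mul_comm s j]; exact Nat.mul_le_mul_left _ h
      omega
    calc _ = (s.descFactorial j * d^j) * ((s-j)*d) := by ring
      _ ≤ (s^j * d.descFactorial j) * (s * (d-j)) := Nat.mul_le_mul ih h1
      _ = _ := by ring

lemma choose_ratio (s d j : ℕ) (h : s ≤ d) (hj : j ≤ d) (hd : 0 < d) :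
    ((s.choose j : ℝ) / d.choose j) ≤ ((s:ℝ)/d)^j := by
  have hp : (0:ℝ) < d.choose j := by exact_mod_cast Nat.choose_pos hj
  have hd' : (0:ℝ) < d := by exact_mod_cast hd
  rw [div_pow, div_le_div_iff₀ hp (by positivity)]
  have := desc_ineq s d j h
  rw [Nat.descFactorial_eq_factorial_mul_choose, Nat.descFactorial_eq_factorial_mul_choose] at this
  have h2 : s.choose j * d^j ≤ s^j * d.choose j := by
    refine Nat.le_of_mul_le_mul_left ?_ (Nat.factorial_pos j)
    calc _ = j.factorial * s.choose j * d^j := by ring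
      _ ≤ _ := this
      _ = _ := by ring
  exact_mod_cast h2

open Finset in
lemma sum_three (t d : ℕ) (h : t ≤ d) : ∑ j ∈ range (d+1), (2:ℝ)^j * t.choose j = 3^t := by
  rw [← sum_subset (range_subset_range.mpr (Nat.succ_le_succ h))]
  · rw [show (3:ℝ) = 2 + 1 by norm_num, add_pow]; simp
  · intro j _ hj
    rw [Nat.choose_eq_zero_of_lt (by simpa using hj)]; simp

open Finset in
lemma tail_bound (s D d k t m : ℕ) (hs : s ≤ D) (hD : D ≤ d) (hd : 0 < d) (ht : t ≤ k) (hk : k ≤ d) :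
    |∑ j ∈ range (d+1) with ¬ j ≤ m, (-2:ℝ)^j * (s.choose j / d.choose j) * t.choose j|
      ≤ 3^k * ((D:ℝ)/d)^(m+1) := by
  have hd' : (0:ℝ) < d := by exact_mod_cast hd
  have hDr : (D:ℝ)/d ≤ 1 := by rw [div_le_one hd']; exact_mod_cast hD
  have hD0 : 0 ≤ (D:ℝ)/d := by positivity
  calc _ ≤ ∑ j ∈ range (d+1) with ¬ j ≤ m, |(-2:ℝ)^j * (s.choose j / d.choose j) * t.choose j| :=
        abs_sum_le_sum_abs _ _
    _ ≤ ∑ j ∈ range (d+1) with ¬ j ≤ m, ((D:ℝ)/d)^(m+1) * (2^j * t.choose j) := by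
        refine sum_le_sum fun j hj => ?_
        simp only [mem_filter, mem_range] at hj
        have h1 := choose_ratio s d j (hs.trans hD) (by omega) hd
        have h2 : ((s:ℝ)/d)^j ≤ ((D:ℝ)/d)^j := by gcongr
        have h3 : ((D:ℝ)/d)^j ≤ ((D:ℝ)/d)^(m+1) := pow_le_pow_of_le_one hD0 hDr (by omega)
        have h4 : (0:ℝ) ≤ (s.choose j : ℝ) / d.choose j := by positivity
        rw [abs_mul, abs_mul, abs_pow, abs_neg, abs_two, abs_of_nonneg h4, Nat.abs_cast]
        have h5 := (h1.trans h2).trans h3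
        calc _ = ((s.choose j : ℝ) / d.choose j) * (2^j * t.choose j) := by ring
          _ ≤ _ := mul_le_mul_of_nonneg_right h5 (by positivity)
    _ ≤ ∑ j ∈ range (d+1), ((D:ℝ)/d)^(m+1) * (2^j * t.choose j) :=
        sum_le_sum_of_subset_of_nonneg (filter_subset _ _) (fun _ _ _ => by positivity)
    _ = 3^t * ((D:ℝ)/d)^(m+1) := by rw [← mul_sum, sum_three t d (ht.trans hk), mul_comm]
    _ ≤ _ := by
        gcongr
        norm_num

open Finset in
lemma le_polyDegree {d : ℕ} (c : Finset (Fin d) → ℝ) (S : Finset (Fin d)) (h : c S ≠ 0) :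
    #S ≤ polyDegree c := by
  unfold polyDegree
  exact Finset.le_sup (f := Finset.card) (by simp [h])

open Finset in
lemma polyDegree_le {d : ℕ} (c : Finset (Fin d) → ℝ) : polyDegree c ≤ d := by
  unfold polyDegree
  refine Finset.sup_le fun S _ => ?_
  simpa using card_le_univ S

open Finset Polynomial in
lemma main_ineq (d k m : ℕ) (hk1 : 1 ≤ k) (hkd : k ≤ d) (hm : 16 * m^2 ≤ k) (c : Finset (Fin d) → ℝ)
    (happ : ∀ x ∈ cube d, hamming x ≤ k → |evalPoly c x - ORd x| ≤ 1 / 6) :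
    1/6 < weight c * (3^k * ((polyDegree c : ℝ)/d)^(m+1)) := by
  by_contra! hcon
  have hd : 0 < d := by omega
  let B : ℕ → ℝ[X] := fun j => C ((j.factorial:ℝ)⁻¹) * descPochhammer ℝ j
  have hB : ∀ j t : ℕ, (B j).eval (t:ℝ) = t.choose j := by
    intro j t
    simp only [B, eval_mul, eval_C, descPochhammer_eval_eq_descFactorial,
      Nat.descFactorial_eq_factorial_mul_choose]
    push_cast
    have : (j.factorial:ℝ) ≠ 0 := by positivity
    field_simp
  let r : ℝ[X] := ∑ S : Finset (Fin d), ∑ j ∈ range (d+1) with j ≤ m,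
    C (c S * ((-2:ℝ)^j * ((#S).choose j / d.choose j))) * B j
  have hdeg : r.natDegree ≤ m := by
    refine natDegree_sum_le_of_forall_le _ _ fun S _ => ?_
    refine natDegree_sum_le_of_forall_le _ _ fun j hj => ?_
    simp only [mem_filter] at hj
    refine (natDegree_C_mul_le _ _).trans ((natDegree_C_mul_le _ _).trans ?_)
    rw [descPochhammer_natDegree]; exact hj.2
  have hr : ∀ t : ℕ, r.eval (t:ℝ) = ∑ S : Finset (Fin d), c S *
      ∑ j ∈ range (d+1) with j ≤ m, ((-2:ℝ)^j * ((#S).choose j / d.choose j)) * t.choose j := by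
    intro t
    simp only [r, eval_finsetSum, eval_mul, eval_C, hB, mul_sum]
    refine sum_congr rfl fun S _ => sum_congr rfl fun j _ => by ring
  let q : ℕ → ℝ := fun t => ∑ S : Finset (Fin d), c S *
      ∑ j ∈ range (d+1), ((-2:ℝ)^j * ((#S).choose j / d.choose j)) * t.choose j
  have hqr : ∀ t ≤ k, |q t - r.eval (t:ℝ)| ≤ 1/6 := by
    intro t ht
    refine le_trans ?_ hcon
    rw [hr, ← sum_sub_distrib, weight, sum_mul]
    refine (abs_sum_le_sum_abs _ _).trans (sum_le_sum fun S _ => ?_)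
    rw [← mul_sub, abs_mul]
    by_cases hS : c S = 0
    · simp [hS]
    refine mul_le_mul_of_nonneg_left ?_ (abs_nonneg _)
    rw [← sum_filter_add_sum_filter_not (range (d+1)) (fun j => j ≤ m), add_sub_cancel_left]
    exact tail_bound _ _ d k t m (le_polyDegree c S hS) (polyDegree_le c) hd ht hkd
  have hq : ∀ t ≤ k, |q t - (if t = 0 then 1 else -1)| ≤ 1/6 := by
    intro t ht
    have hp : (0:ℝ) < d.choose t := by exact_mod_cast Nat.choose_pos (ht.trans hkd)
    have e1 : ∑ T ∈ powersetCard t (univ : Finset (Fin d)), evalPoly c (ptOf T) = d.choose t * q t := by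
      simp only [evalPoly, q]
      rw [sum_comm, mul_sum]
      refine sum_congr rfl fun S _ => ?_
      rw [← mul_sum, avg_char]; ring
    have e2 : (d.choose t : ℝ) * (q t - (if t = 0 then 1 else -1)) =
        ∑ T ∈ powersetCard t (univ : Finset (Fin d)), (evalPoly c (ptOf T) - (if t = 0 then 1 else -1)) := by
      rw [sum_sub_distrib, e1, sum_const, card_powersetCard, card_univ, Fintype.card_fin, nsmul_eq_mul]
      ring
    have e3 : (d.choose t : ℝ) * |q t - (if t = 0 then 1 else -1)| ≤ d.choose t * (1/6) := by
      rw [← abs_of_pos hp, ← abs_mul, abs_of_pos hp, e2]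
      refine (abs_sum_le_sum_abs _ _).trans ?_
      calc _ ≤ ∑ T ∈ powersetCard t (univ : Finset (Fin d)), (1/6:ℝ) := by
            refine sum_le_sum fun T hT => ?_
            rw [mem_powersetCard] at hT
            have := happ (ptOf T) (ptOf_mem T) (by rw [hamming_ptOf]; omega)
            rwa [OR_ptOf, hT.2] at this
        _ = _ := by rw [sum_const, card_powersetCard, card_univ, Fintype.card_fin, nsmul_eq_mul]
    exact le_of_mul_le_mul_left e3 hp
  have hfin : ∀ t ≤ k, |r.eval (t:ℝ) - (if t = 0 then 1 else -1)| ≤ 1/3 := by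
    intro t ht
    have h1 := abs_le.mp (hqr t ht)
    have h2 := abs_le.mp (hq t ht)
    rw [abs_le]; constructor <;> linarith
  refine no_poly m r hdeg ?_ ?_
  · simpa using hfin 0 (by omega)
  · intro j hj
    unfold nodeV
    by_cases h0 : j = 0
    · simpa [h0] using hfin 1 hk1
    · rw [if_neg h0]
      have h1 : 16 * j^2 ≤ k := le_trans (by gcongr) hm
      have h2 := hfin (16*j^2) h1
      have h3 : 16 * j^2 ≠ 0 := by positivity
      rw [if_neg h3] at h2
      push_cast at h2
      rwa [sub_neg_eq_add] at h2

lemma weight_ge (d k : ℕ) (c : Finset (Fin d) → ℝ)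
    (happ : ∀ x ∈ cube d, hamming x ≤ k → |evalPoly c x - ORd x| ≤ 1 / 6) : 5/6 ≤ weight c := by
  have h := happ (ptOf ∅) (ptOf_mem _) (by rw [hamming_ptOf]; simp)
  rw [OR_ptOf] at h
  simp only [Finset.card_empty, if_true] at h
  have h2 : evalPoly c (ptOf (∅ : Finset (Fin d))) ≤ weight c := by
    unfold evalPoly weight
    refine Finset.sum_le_sum fun S _ => ?_
    simp [ptOf, le_abs_self]
  have := (abs_le.mp h).1
  linarith

/-- final numeric step, in terms of `u = √k` -/
lemma numeric (u W ρ : ℝ) (n : ℕ) (hu : 1 ≤ u) (hW : 5/6 ≤ W) (hρ0 : 0 < ρ) (hρ1 : ρ ≤ 1) (hn : u/4 ≤ n)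
    (h : 1/6 < W * (3^(u^2) * ρ^n)) :
    100 * W^(-(100/u)) / 2^(100*u) ≤ ρ := by
  have hu0 : 0 < u := by linarith
  have hW0 : 0 < W := by linarith
  have hlogW : -(1/5) ≤ Real.log W := by
    have h1 := Real.one_sub_inv_le_log_of_pos hW0
    have h2 : W⁻¹ ≤ 6/5 := by
      rw [inv_le_comm₀ hW0 (by norm_num)]; linarith
    linarith
  have hl2 := Real.log_two_gt_d9
  have hl2' := Real.log_two_lt_d9
  have hρl : Real.log ρ ≤ 0 := Real.log_nonpos hρ0.le hρ1
  have h6 : Real.log 6 ≤ 3 * Real.log 2 := by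
    rw [← Real.log_rpow (by norm_num)]
    apply Real.log_le_log (by norm_num); norm_num
  have h3 : Real.log 3 ≤ 2 * Real.log 2 := by
    rw [← Real.log_rpow (by norm_num)]
    apply Real.log_le_log (by norm_num); norm_num
  have h100 : Real.log 100 ≤ 7 * Real.log 2 := by
    rw [← Real.log_rpow (by norm_num)]
    apply Real.log_le_log (by norm_num); norm_num
  have hlog := Real.log_lt_log (by norm_num) h
  rw [Real.log_mul hW0.ne' (by positivity), Real.log_mul (by positivity) (by positivity),
    Real.log_rpow (by norm_num), Real.log_pow, one_div, Real.log_inv] at hlog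
  have hnρ : n * Real.log ρ ≤ u/4 * Real.log ρ := mul_le_mul_of_nonpos_right hn hρl
  have hp : 0 < 100 * W^(-(100/u)) / 2^(100*u) := by positivity
  rw [← Real.log_le_log_iff hp hρ0, Real.log_div (by positivity) (by positivity),
    Real.log_mul (by norm_num) (by positivity), Real.log_rpow hW0, Real.log_rpow (by norm_num)]
  have key : u * (Real.log 100 + -(100/u) * Real.log W - 100*u * Real.log 2) ≤ u * Real.log ρ := by
    have e : u * (Real.log 100 + -(100/u) * Real.log W - 100*u * Real.log 2)
        = u * Real.log 100 - 100 * Real.log W - 100 * u^2 * Real.log 2 := by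
      field_simp
      ring
    rw [e]
    have a1 : u * Real.log 100 ≤ u^2 * (7 * Real.log 2) := by
      have : u ≤ u^2 := by nlinarith
      exact mul_le_mul this h100 (Real.log_nonneg (by norm_num)) (by positivity)
    have a2 : u^2 * Real.log 3 ≤ u^2 * (2 * Real.log 2) := by gcongr
    have a3 : 1 ≤ u^2 := by nlinarith
    have a4 : Real.log 2 ≤ u^2 * Real.log 2 := by nlinarith
    nlinarith
  exact le_of_mul_le_mul_left key hu0

theorem stmt_13 : ∃ C > (0 : ℝ), ∀ d k : ℕ, 1 ≤ k → k ≤ d →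
    ∀ W : ℝ, W ≤ (1 / 6) * 2 ^ (-(k : ℝ)) * ((d : ℝ) / k) ^ (C * Real.sqrt k) →
    ∀ c : Finset (Fin d) → ℝ, weight c ≤ W →
      (∀ x ∈ cube d, hamming x ≤ k → |evalPoly c x - ORd x| ≤ 1 / 6) →
      (1 / C) * ((d : ℝ) / Real.sqrt k) * W ^ (-(1 / (C * Real.sqrt k)))
          / 2 ^ (Real.sqrt k / C)
        ≤ polyDegree c := by
  refine ⟨1/100, by norm_num, ?_⟩
  intro d k hk1 hkd W _ c hcW happ
  have hd : (0:ℝ) < d := by exact_mod_cast (by omega : 0 < d)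
  have hW : 5/6 ≤ W := (weight_ge d k c happ).trans hcW
  set u := Real.sqrt k with hu
  have hu1 : 1 ≤ u := by
    rw [hu, Real.one_le_sqrt]; exact_mod_cast hk1
  have hu0 : 0 < u := by linarith
  have husq : u^2 = k := Real.sq_sqrt (Nat.cast_nonneg k)
  set m := ⌊u/4⌋₊ with hm
  have hm1 : (m:ℝ) ≤ u/4 := Nat.floor_le (by positivity)
  have hm2 : u/4 ≤ ((m+1 : ℕ):ℝ) := by push_cast; exact (Nat.lt_floor_add_one _).le
  have hmk : 16 * m^2 ≤ k := by
    have : (16:ℝ) * m^2 ≤ k := by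
      rw [← husq]
      have : (0:ℝ) ≤ m := by positivity
      nlinarith
    exact_mod_cast this
  have hmain := main_ineq d k m hk1 hkd hmk c happ
  have hmain' : 1/6 < W * (3^(u^2) * ((polyDegree c : ℝ)/d)^(m+1)) := by
    rw [husq, Real.rpow_natCast]
    exact lt_of_lt_of_le hmain (mul_le_mul_of_nonneg_right hcW (by positivity))
  have hρ0 : 0 < (polyDegree c : ℝ)/d := by
    rcases (show 0 ≤ (polyDegree c : ℝ)/d by positivity).eq_or_lt with h | h
    · rw [← h] at hmain'; norm_num at hmain'
    · exact h
  have hρ1 : (polyDegree c : ℝ)/d ≤ 1 := by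
    rw [div_le_one hd]; exact_mod_cast polyDegree_le c
  have hfin := numeric u W _ (m+1) hu1 hW hρ0 hρ1 hm2 hmain'
  rw [le_div_iff₀ hd] at hfin
  refine le_trans ?_ hfin
  have e1 : -(1 / (1/100 * u)) = -(100/u) := by field_simp
  have e2 : u / (1/100) = 100 * u := by ring
  rw [e1, e2, one_div_one_div]
  have h4 : (d:ℝ)/u ≤ d := div_le_self hd.le hu1
  have hW0 : 0 < W := by linarith
  calc _ = (d:ℝ)/u * (100 * W^(-(100/u)) / 2^(100*u)) := by ring
    _ ≤ d * (100 * W^(-(100/u)) / 2^(100*u)) := mul_le_mul_of_nonneg_right h4 (by positivity)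
    _ = _ := by ring
end

section
/- Any d-variate polynomial of weight W that approximates the OR_d function to within 1/6 pointwise on all Boolean inputs {-1,1}^d must have degree at least d/2^{O(√(log W))}. -/
open Polynomial in
/-- Chebyshev extrapolation. -/
lemma cheb_extrap (T : ℝ[X]) (m : ℕ) (hT : T.natDegree ≤ m) (s : ℝ) (hs0 : 0 < s) (hs : s ≤ 1 / 2)
    (hb : ∀ u, s ≤ u → u ≤ 1 → |T.eval u| ≤ 1) (h0 : 2 ≤ T.eval 0) :
    1 ≤ 8 * (m : ℝ) ^ 2 * s := by
  set P : ℝ[X] := T.comp (C ((1 + s) / 2) - C ((1 - s) / 2) * X) with hP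
  have hev : ∀ x, P.eval x = T.eval ((1 + s) / 2 - (1 - s) / 2 * x) := by
    intro x; simp [hP, eval_comp]
  have hdeg : P.degree ≤ m := by
    apply Polynomial.degree_le_of_natDegree_le
    refine (Polynomial.natDegree_comp_le).trans ?_
    have h1 : (C ((1 + s) / 2) - C ((1 - s) / 2) * X : ℝ[X]).natDegree ≤ 1 := by
      refine (natDegree_sub_le _ _).trans ?_
      refine max_le (by simp) ((natDegree_C_mul_le _ _).trans natDegree_X_le)
    calc _ ≤ m * 1 := Nat.mul_le_mul hT h1
      _ = m := by simp
  have hbd : ∀ x ∈ Set.Icc (-1 : ℝ) 1, |P.eval x| ≤ 1 := by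
    intro x hx
    rw [hev]
    apply hb <;> nlinarith [hx.1, hx.2]
  have h1s : 0 < 1 - s := by linarith
  set x0 := (1 + s) / (1 - s) with hx0
  have hx1 : 1 ≤ x0 := by rw [hx0, le_div_iff₀ h1s]; linarith
  have key := Polynomial.Chebyshev.eval_iterate_derivative_le_of_forall_abs_le_one
    (k := 0) hx1 hdeg hbd
  simp only [Function.iterate_zero, id_eq] at key
  rw [hev, show (1 + s) / 2 - (1 - s) / 2 * x0 = 0 by rw [hx0]; field_simp; ring] at key
  set θ := Real.arcosh x0 with hθ
  have hθ0 : 0 ≤ θ := Real.arcosh_nonneg hx1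
  have hc : Real.cosh θ = x0 := Real.cosh_arcosh hx1
  rw [← hc, Polynomial.Chebyshev.T_real_cosh] at key
  have hm : 1 ≤ (m : ℝ) * θ := by
    by_contra hlt
    push Not at hlt
    have hnn : 0 ≤ (m : ℝ) * θ := by positivity
    have h2 := Real.cosh_le_exp_half_sq ((m : ℝ) * θ)
    have h3 : Real.exp (((m : ℝ) * θ) ^ 2 / 2) ≤ Real.exp (1 / 2) := by
      apply Real.exp_le_exp.2; nlinarith
    have h4 : Real.exp (1 / 2) < 2 := by
      have e1 : Real.exp (1 / 2) * Real.exp (1 / 2) = Real.exp 1 := by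
        rw [← Real.exp_add]; norm_num
      have := Real.exp_one_lt_d9
      have := Real.exp_pos (1 / 2)
      nlinarith
    simp only [Int.cast_natCast] at key
    linarith
  have hsq : 1 + θ ^ 2 / 2 ≤ Real.cosh θ := by
    have e : Real.cosh θ = 1 + 2 * Real.sinh (θ / 2) ^ 2 := by
      have := Real.cosh_two_mul (θ / 2)
      rw [show 2 * (θ / 2) = θ by ring] at this
      have := Real.cosh_sq (θ / 2)
      linarith
    have : θ / 2 ≤ Real.sinh (θ / 2) := Real.self_le_sinh_iff.2 (by positivity)
    rw [e]; nlinarith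
  have hx4 : x0 ≤ 1 + 4 * s := by
    rw [hx0, div_le_iff₀ h1s]; nlinarith
  have : θ ^ 2 ≤ 8 * s := by linarith
  calc (1 : ℝ) ≤ ((m : ℝ) * θ) ^ 2 := by nlinarith
    _ = (m : ℝ) ^ 2 * θ ^ 2 := by ring
    _ ≤ (m : ℝ) ^ 2 * (8 * s) := by gcongr
    _ = _ := by ring

open Polynomial in
/-- Truncated binomial expansion of `(1 + a X)^k`. -/
noncomputable def truncBin (m k : ℕ) (a : ℝ) : ℝ[X] :=
  ∑ j ∈ Finset.range (k + 1), if j < m then C ((k.choose j : ℝ) * a ^ j) * X ^ j else 0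

open Polynomial in
lemma truncBin_natDegree (m k : ℕ) (a : ℝ) : (truncBin m k a).natDegree ≤ m := by
  unfold truncBin
  apply Polynomial.natDegree_sum_le_of_forall_le
  intro j _
  split_ifs with h
  · exact (natDegree_C_mul_X_pow_le _ _).trans h.le
  · simp

open Polynomial in
lemma truncBin_err (m k D : ℕ) (hk : k ≤ D) (hD : 1 ≤ D) (u : ℝ) (hu0 : 0 ≤ u) (hu : u ≤ 1) :
    |(1 - u / (2 * D)) ^ k - (truncBin m k (-(1 / (2 * D)))).eval u| ≤ 3 / 2 ^ m := by
  have hD' : (0 : ℝ) < D := by exact_mod_cast hD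
  have e1 : (1 - u / (2 * D)) ^ k - (truncBin m k (-(1 / (2 * D)))).eval u
      = ∑ j ∈ Finset.range (k + 1),
        if j < m then 0 else (k.choose j : ℝ) * (-(u / (2 * D))) ^ j := by
    rw [show (1 - u / (2 * D)) = -(u / (2 * D)) + 1 by ring, add_pow, truncBin, eval_finsetSum,
      ← Finset.sum_sub_distrib]
    apply Finset.sum_congr rfl
    intro j _
    split_ifs with h
    · simp only [eval_mul, eval_C, eval_pow, eval_X, one_pow, mul_one]
      rw [show -(u / (2 * D)) = -(1 / (2 * (D : ℝ))) * u by ring, mul_pow]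
      ring
    · simp; ring
  rw [e1]
  have h2 : ∀ j ∈ Finset.range (k + 1),
      |if j < m then (0 : ℝ) else (k.choose j : ℝ) * (-(u / (2 * D))) ^ j|
        ≤ ((D : ℝ)⁻¹ ^ j * 1 ^ (k - j) * (k.choose j : ℝ)) / 2 ^ m := by
    intro j _
    split_ifs with h
    · simp; positivity
    · rw [abs_mul, abs_pow, abs_neg, abs_of_nonneg (by positivity : (0 : ℝ) ≤ u / (2 * D)),
        abs_of_nonneg (by positivity : (0 : ℝ) ≤ (k.choose j : ℝ))]
      have h3 : (u / (2 * D)) ^ j ≤ (D : ℝ)⁻¹ ^ j / 2 ^ m := by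
        calc (u / (2 * D)) ^ j ≤ (1 / (2 * D)) ^ j := by gcongr
          _ = (D : ℝ)⁻¹ ^ j / 2 ^ j := by
            rw [← div_pow]; congr 1; field_simp
          _ ≤ _ := by
            gcongr
            · norm_num
            · omega
      calc _ ≤ (k.choose j : ℝ) * ((D : ℝ)⁻¹ ^ j / 2 ^ m) := by gcongr
        _ = _ := by simp; ring
  refine (Finset.abs_sum_le_sum_abs _ _).trans ((Finset.sum_le_sum h2).trans ?_)
  rw [← Finset.sum_div, ← add_pow]
  gcongr
  calc ((D : ℝ)⁻¹ + 1) ^ k ≤ ((D : ℝ)⁻¹ + 1) ^ D := by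
        apply pow_le_pow_right₀ _ hk
        have : 0 < (D : ℝ)⁻¹ := by positivity
        linarith
    _ = (1 + (D : ℝ)⁻¹) ^ D := by rw [add_comm]
    _ ≤ Real.exp 1 := Real.one_add_inv_pow_le_exp
    _ ≤ 3 := by linarith [Real.exp_one_lt_d9]

/-- The cube point with `-1` exactly on `A`. -/
noncomputable def cubePt {d : ℕ} (A : Finset (Fin d)) : Fin d → ℝ := fun i => if i ∈ A then -1 else 1

lemma cubePt_mem {d : ℕ} (A : Finset (Fin d)) : cubePt A ∈ cube d := by
  intro i
  unfold cubePt
  split_ifs <;> simp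

lemma ORd_cubePt {d : ℕ} (A : Finset (Fin d)) : ORd (cubePt A) = if A = ∅ then 1 else -1 := by
  unfold ORd cubePt
  by_cases h : A = ∅
  · subst h
    have : ¬ ((1 : ℝ) = -1) := by norm_num
    simp [this]
  · obtain ⟨i, hi⟩ := Finset.nonempty_iff_ne_empty.2 h
    rw [if_neg h, if_pos ⟨i, by simp [hi]⟩]

/-- The product-distribution weight of `A`. -/
noncomputable def wt {d : ℕ} (t : ℝ) (A : Finset (Fin d)) : ℝ :=
  (∏ _i ∈ A, (1 - t) / 2) * ∏ _i ∈ Finset.univ \ A, (1 + t) / 2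

lemma mono_avg {d : ℕ} (t : ℝ) (S : Finset (Fin d)) :
    ∑ A : Finset (Fin d), wt t A * ∏ i ∈ S, cubePt A i = t ^ S.card := by
  have h := Finset.prod_add (fun i : Fin d => (1 - t) / 2 * (if i ∈ S then -1 else 1))
    (fun _ => (1 + t) / 2) Finset.univ
  rw [Finset.powerset_univ] at h
  have e1 : ∏ i : Fin d, ((1 - t) / 2 * (if i ∈ S then -1 else 1) + (1 + t) / 2) = t ^ S.card := by
    rw [← Finset.prod_const, ← Finset.prod_subset (Finset.subset_univ S)]
    · apply Finset.prod_congr rfl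
      intro i hi
      simp [hi]; ring
    · intro i _ hi
      simp [hi]; ring
  rw [← e1, h]
  apply Finset.sum_congr rfl
  intro A _
  have e2 : ∏ i ∈ S, cubePt A i = ∏ i ∈ A, (if i ∈ S then (-1 : ℝ) else 1) := by
    unfold cubePt
    rw [Finset.prod_ite_mem, Finset.prod_ite_mem, Finset.inter_comm]
  rw [e2, wt, Finset.prod_mul_distrib]
  ring

lemma poly_avg {d : ℕ} (c : Finset (Fin d) → ℝ) (t : ℝ) :
    ∑ A : Finset (Fin d), wt t A * evalPoly c (cubePt A) = ∑ S, c S * t ^ S.card := by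
  unfold evalPoly
  simp_rw [Finset.mul_sum]
  rw [Finset.sum_comm]
  apply Finset.sum_congr rfl
  intro S _
  rw [← mono_avg, Finset.mul_sum]
  apply Finset.sum_congr rfl
  intro A _
  ring

lemma avg_bound {d : ℕ} (c : Finset (Fin d) → ℝ)
    (h : ∀ x ∈ cube d, |evalPoly c x - ORd x| ≤ 1 / 6) (t : ℝ) (ht0 : -1 ≤ t) (ht1 : t ≤ 1) :
    |(∑ S, c S * t ^ S.card) - (2 * ((1 + t) / 2) ^ d - 1)| ≤ 1 / 6 := by
  have hw : ∀ A : Finset (Fin d), 0 ≤ wt t A := by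
    intro A
    unfold wt
    apply mul_nonneg <;> apply Finset.prod_nonneg <;> intros <;> linarith
  have hsum : ∑ A : Finset (Fin d), wt t A = 1 := by
    simpa using mono_avg t (∅ : Finset (Fin d))
  have hor : ∑ A : Finset (Fin d), wt t A * ORd (cubePt A) = 2 * ((1 + t) / 2) ^ d - 1 := by
    have : ∀ A : Finset (Fin d), wt t A * ORd (cubePt A)
        = (if A = ∅ then 2 * wt t A else 0) - wt t A := by
      intro A
      rw [ORd_cubePt]
      split_ifs <;> ring
    simp_rw [this]
    rw [Finset.sum_sub_distrib, hsum, Finset.sum_ite_eq' Finset.univ]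
    simp [wt, div_pow]
  rw [← poly_avg, ← hor, ← Finset.sum_sub_distrib]
  calc _ ≤ ∑ A : Finset (Fin d), |wt t A * evalPoly c (cubePt A) - wt t A * ORd (cubePt A)| :=
        Finset.abs_sum_le_sum_abs _ _
    _ ≤ ∑ A : Finset (Fin d), wt t A * (1 / 6) := by
        apply Finset.sum_le_sum
        intro A _
        rw [← mul_sub, abs_mul, abs_of_nonneg (hw A)]
        exact mul_le_mul_of_nonneg_left (h _ (cubePt_mem A)) (hw A)
    _ = 1 / 6 := by rw [← Finset.sum_mul, hsum, one_mul]

open Polynomial in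
lemma core_s15 {d : ℕ} (c : Finset (Fin d) → ℝ)
    (h : ∀ x ∈ cube d, |evalPoly c x - ORd x| ≤ 1 / 6) (D m : ℕ) (hD : 1 ≤ D) (hd : 1 ≤ d)
    (hdeg : ∀ S, c S ≠ 0 → S.card ≤ D) (hm : 300 * weight c ≤ 2 ^ m) (hs : 24 * D ≤ d) :
    (d : ℝ) ≤ 96 * (m : ℝ) ^ 2 * D := by
  have hD' : (0 : ℝ) < D := by exact_mod_cast hD
  have hd' : (0 : ℝ) < d := by exact_mod_cast hd
  have hs' : 24 * (D : ℝ) ≤ d := by exact_mod_cast hs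
  set T : ℝ[X] := ∑ S, C (c S) * truncBin m S.card (-(1 / (2 * D))) with hT
  have hTd : T.natDegree ≤ m := by
    apply Polynomial.natDegree_sum_le_of_forall_le
    intro S _
    exact (natDegree_C_mul_le _ _).trans (truncBin_natDegree _ _ _)
  have herr : ∀ u, 0 ≤ u → u ≤ 1 →
      |(∑ S, c S * (1 - u / (2 * D)) ^ S.card) - T.eval u| ≤ 1 / 100 := by
    intro u hu0 hu1
    rw [hT, eval_finsetSum, ← Finset.sum_sub_distrib]
    calc _ ≤ ∑ S, |c S * (1 - u / (2 * D)) ^ S.card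
            - (C (c S) * truncBin m S.card (-(1 / (2 * D)))).eval u| :=
          Finset.abs_sum_le_sum_abs _ _
      _ ≤ ∑ S, |c S| * (3 / 2 ^ m) := by
          apply Finset.sum_le_sum
          intro S _
          rw [eval_mul, eval_C, ← mul_sub, abs_mul]
          by_cases hc : c S = 0
          · simp [hc]
          · gcongr
            exact truncBin_err m S.card D (hdeg S hc) hD u hu0 hu1
      _ = weight c * (3 / 2 ^ m) := by rw [← Finset.sum_mul, weight]
      _ ≤ 1 / 100 := by
          rw [← mul_div_assoc, div_le_iff₀ (by positivity)]
          linarith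
  set s : ℝ := 12 * D / d with hsdef
  have hspos : 0 < s := by positivity
  have hshalf : s ≤ 1 / 2 := by
    rw [hsdef, div_le_iff₀ hd']; linarith
  have hDinv : ∀ u : ℝ, 0 ≤ u → u ≤ 1 → 0 ≤ u / (2 * D) ∧ u / (2 * D) ≤ 1 := by
    intro u h0 h1
    refine ⟨by positivity, ?_⟩
    rw [div_le_iff₀ (by positivity)]
    have : (1 : ℝ) ≤ D := by exact_mod_cast hD
    linarith
  have hexp3 : Real.exp (-3) ≤ 1 / 19 := by
    have e : Real.exp 3 = Real.exp 1 ^ 3 := by rw [← Real.exp_nat_mul]; norm_num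
    have : (19 : ℝ) ≤ Real.exp 3 := by
      rw [e]
      calc (19 : ℝ) ≤ 2.7 ^ 3 := by norm_num
        _ ≤ _ := by gcongr; linarith [Real.exp_one_gt_d9]
    rw [Real.exp_neg, ← one_div]
    exact one_div_le_one_div_of_le (by norm_num) this
  have hR := cheb_extrap (C (7 / 2) * (T + 1)) m ?_ s hspos hshalf ?_ ?_
  · rw [hsdef, ← mul_div_assoc, le_div_iff₀ hd'] at hR
    linarith
  · refine (natDegree_C_mul_le _ _).trans ((natDegree_add_le _ _).trans (max_le hTd (by simp)))
  · intro u hu0 hu1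
    have hu00 : 0 ≤ u := by linarith
    have h1 := herr u hu00 hu1
    obtain ⟨ha, hb⟩ := hDinv u hu00 hu1
    have h2 := avg_bound c h (1 - u / (2 * D)) (by linarith) (by linarith)
    have h3 : ((1 + (1 - u / (2 * D))) / 2) ^ d ≤ 1 / 19 := by
      calc ((1 + (1 - u / (2 * D))) / 2) ^ d ≤ (Real.exp (-(u / (4 * D)))) ^ d := by
            apply pow_le_pow_left₀ (by linarith)
            have := Real.add_one_le_exp (-(u / (4 * D)))
            have e : u / (4 * D) = u / (2 * D) / 2 := by field_simp; norm_num
            rw [e] at this ⊢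
            linarith
        _ = Real.exp (d * (-(u / (4 * D)))) := by rw [Real.exp_nat_mul]
        _ ≤ Real.exp (-3) := by
            apply Real.exp_le_exp.2
            have : 3 ≤ d * (u / (4 * D)) := by
              rw [← mul_div_assoc, le_div_iff₀ (by positivity)]
              have : s * d = 12 * D := by rw [hsdef]; field_simp
              nlinarith
            linarith
        _ ≤ _ := hexp3
    have h4 : 0 ≤ ((1 + (1 - u / (2 * D))) / 2) ^ d := pow_nonneg (by linarith) _
    simp only [eval_mul, eval_C, eval_add, eval_one]
    rw [abs_le] at h1 h2 ⊢
    constructor <;> linarith [h1.1, h1.2, h2.1, h2.2]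
  · have h1 := herr 0 le_rfl zero_le_one
    have h2 := avg_bound c h 1 (by norm_num) le_rfl
    simp only [eval_mul, eval_C, eval_add, eval_one]
    norm_num at h1 h2
    rw [abs_le] at h1 h2
    linarith [h1.1, h1.2, h2.1, h2.2]

theorem stmt_15 : ∃ C > (0 : ℝ), ∀ d : ℕ, ∀ W : ℝ,
    ∀ c : Finset (Fin d) → ℝ, weight c ≤ W →
      (∀ x ∈ cube d, |evalPoly c x - ORd x| ≤ 1 / 6) →
      (d : ℝ) / 2 ^ (C * (Real.sqrt (Real.log W) + 1)) ≤ polyDegree c := by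
  refine ⟨18, by norm_num, ?_⟩
  intro d W c hW h
  rcases Nat.eq_zero_or_pos d with hd0 | hd
  · subst hd0; simp
  set D := polyDegree c with hDdef
  have hdeg : ∀ S, c S ≠ 0 → S.card ≤ D := by
    intro S hS
    rw [hDdef]
    unfold polyDegree
    apply Finset.le_sup (f := Finset.card)
    simp [hS]
  have h1 := avg_bound c h 1 (by norm_num) le_rfl
  have hm1 := avg_bound c h (-1) le_rfl (by norm_num)
  have hD : 1 ≤ D := by
    by_contra hlt
    have e : ∀ t : ℝ, ∑ S, c S * t ^ S.card = ∑ S, c S := by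
      intro t
      apply Finset.sum_congr rfl
      intro S _
      by_cases hc : c S = 0
      · simp [hc]
      · have : S.card = 0 := by have := hdeg S hc; omega
        simp [this]
    rw [e] at h1 hm1
    have hz : ((1 + (-1 : ℝ)) / 2) ^ d = 0 := by
      norm_num; omega
    rw [hz] at hm1
    norm_num at h1 hm1
    rw [abs_le] at h1 hm1
    linarith [h1.1, hm1.2]
  have hWpos : 0 < W := by
    norm_num at h1
    rw [abs_le] at h1
    have : ∑ S, c S ≤ weight c := Finset.sum_le_sum fun S _ => le_abs_self _
    linarith [h1.1]
  have hD' : (0 : ℝ) < D := by exact_mod_cast hD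
  set r := Real.sqrt (Real.log W) with hr
  have hr0 : 0 ≤ r := Real.sqrt_nonneg _
  have hlog : Real.log W ≤ r ^ 2 := by
    by_cases hl : 0 ≤ Real.log W
    · rw [hr, Real.sq_sqrt hl]
    · push Not at hl
      nlinarith [sq_nonneg r]
  have hl2 : 0.69 < Real.log 2 := by linarith [Real.log_two_gt_d9]
  set m : ℕ := ⌈r ^ 2 / Real.log 2⌉₊ + 9 with hm
  have hmle : (m : ℝ) ≤ 10 * (r + 1) ^ 2 := by
    have h2 : (⌈r ^ 2 / Real.log 2⌉₊ : ℝ) < r ^ 2 / Real.log 2 + 1 :=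
      Nat.ceil_lt_add_one (by positivity)
    have h3 : r ^ 2 / Real.log 2 ≤ 2 * r ^ 2 := by
      rw [div_le_iff₀ (by linarith)]
      nlinarith [sq_nonneg r]
    rw [hm]; push_cast
    nlinarith [sq_nonneg r]
  have hmge : 300 * weight c ≤ 2 ^ m := by
    have h2 : r ^ 2 / Real.log 2 ≤ (⌈r ^ 2 / Real.log 2⌉₊ : ℝ) := Nat.le_ceil _
    rw [div_le_iff₀ (by linarith)] at h2
    have h3 : W ≤ 2 ^ ⌈r ^ 2 / Real.log 2⌉₊ := by
      rw [← Real.log_le_log_iff hWpos (by positivity), Real.log_pow]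
      linarith
    rw [hm, pow_add]
    have : (0 : ℝ) < 2 ^ ⌈r ^ 2 / Real.log 2⌉₊ := by positivity
    norm_num
    linarith
  have hmain : (d : ℝ) ≤ 9600 * (r + 1) ^ 4 * D := by
    by_cases hs : 24 * D ≤ d
    · calc (d : ℝ) ≤ 96 * (m : ℝ) ^ 2 * D := core_s15 c h D m hD hd hdeg hmge hs
        _ ≤ 96 * (10 * (r + 1) ^ 2) ^ 2 * D := by gcongr
        _ = _ := by ring
    · have h2 : (d : ℝ) ≤ 24 * D := by exact_mod_cast (not_le.1 hs).le
      have h3 : (1 : ℝ) ≤ (r + 1) ^ 4 := one_le_pow₀ (by linarith)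
      nlinarith
  have hp : (0 : ℝ) < 2 ^ (18 * (r + 1)) := by positivity
  rw [div_le_iff₀ hp]
  have hx : r + 1 ≤ (2 : ℝ) ^ (r + 1) := by
    have := one_add_mul_self_le_rpow_one_add (s := 1) (by norm_num) (p := r + 1) (by linarith)
    norm_num at this
    linarith
  have h14 : (9600 : ℝ) ≤ 2 ^ (14 * (r + 1)) := by
    calc (9600 : ℝ) ≤ 2 ^ (14 : ℝ) := by
          rw [show (14 : ℝ) = ((14 : ℕ) : ℝ) by norm_num, Real.rpow_natCast]; norm_num
      _ ≤ _ := Real.rpow_le_rpow_of_exponent_le (by norm_num) (by linarith)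
  have h4 : (r + 1) ^ 4 ≤ (2 : ℝ) ^ (4 * (r + 1)) := by
    calc (r + 1) ^ 4 ≤ ((2 : ℝ) ^ (r + 1)) ^ 4 := by gcongr
      _ = _ := by
        rw [← Real.rpow_natCast, ← Real.rpow_mul (by norm_num)]
        congr 1; push_cast; ring
  calc (d : ℝ) ≤ 9600 * (r + 1) ^ 4 * D := hmain
    _ ≤ 2 ^ (14 * (r + 1)) * 2 ^ (4 * (r + 1)) * D := by gcongr
    _ = D * 2 ^ (18 * (r + 1)) := by
      rw [← Real.rpow_add (by norm_num)]
      rw [show 14 * (r + 1) + 4 * (r + 1) = 18 * (r + 1) by ring]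
      ring
end
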